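/- arXiv:2401.09005 — 9 statements merged into one kernel-verified Lean document; each statement's English description precedes it below -/
import Mathlib

section
/- Let d ≥ 1 be an integer and α ∈ (0,2). For x,y ∈ ℝ^d write M(x,y) := max(|x|,|y|). Suppose p : (0,∞) × ℝ^d × ℝ^d → [0,∞) is a function for which there exist constants c₁,…,c₈ > 0 such that: (i) for all x,y ∈ ℝ^d and all 0 < t ≤ (1+M(x,y))^{1+α/2}, c₁ t^{-d/2} exp(−c₂(t/(1+M(x,y))^α + |x−y|²/t)) ≤ p(t,x,y) ≤ c₃ t^{-d/2} exp(−c₄(t/(1+M(x,y))^α + |x−y|²/t)); and (ii) for all x,y ∈ ℝ^d and all t > (1+M(x,y))^{1+α/2}, c₅ exp(−c₆ t^{(2−α)/(2+α)}) ≤ p(t,x,y) ≤ c₇ exp(−c₈ t^{(2−α)/(2+α)}). Then there exist constants C₁, C₂, C₃, C₄ > 0 such that for all t > 0 and all x,y ∈ ℝ^d, C₁ t^{-d/2} exp(−C₂ |x−y|²/t) exp(−C₂ min(t/(1+M(x,y))^α, t^{(2−α)/(2+α)})) ≤ p(t,x,y) ≤ C₃ t^{-d/2} exp(−C₄ |x−y|²/t)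 exp(−C₄ min(t/(1+M(x,y))^α, t^{(2−α)/(2+α)})). -/
open Real MeasureTheory

/-- A real power is dominated by an exponential on the positive half-line. -/
theorem rpow_le_mul_exp {k b x : ℝ} (hk : 0 < k) (hb : 0 < b) (hx : 0 < x) :
    x ^ k ≤ (k / b) ^ k * Real.exp (b * x) := by
  have h1 : x ≤ k / b * Real.exp (b * x / k) := by
    have h2 := Real.add_one_le_exp (b * x / k)
    calc x = k / b * (b * x / k) := by field_simp
      _ ≤ _ := by gcongr; linarith
  calc x ^ k ≤ (k / b * Real.exp (b * x / k)) ^ k := by gcongr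
    _ = _ := by
      rw [Real.mul_rpow (by positivity) (by positivity), ← Real.exp_mul]
      congr 2
      field_simp

section TransitionTime

variable {α R t : ℝ}

/-- Before the transition time, the linear rate is the smaller one. -/
theorem div_rpow_le_rpow_of_le (hα : 0 < α) (hR : 0 < R) (ht : 0 < t)
    (h : t ≤ R ^ (1 + α / 2)) : t / R ^ α ≤ t ^ ((2 - α) / (2 + α)) := by
  have h1 : t ^ (2 * α / (2 + α)) ≤ R ^ α := by
    calc t ^ (2 * α / (2 + α)) ≤ (R ^ (1 + α / 2)) ^ (2 * α / (2 + α)) := by gcongr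
      _ = R ^ α := by
        rw [← Real.rpow_mul hR.le]
        congr 1
        field_simp
  rw [div_le_iff₀ (by positivity)]
  calc t = t ^ ((2 - α) / (2 + α)) * t ^ (2 * α / (2 + α)) := by
        rw [← Real.rpow_add ht, ← add_div, show 2 - α + 2 * α = 2 + α by ring,
          div_self (by positivity), Real.rpow_one]
    _ ≤ _ := by gcongr

/-- After the transition time, the sublinear rate is the smaller one. -/
theorem rpow_le_div_rpow_of_le (hα : 0 < α) (hR : 0 < R) (ht : 0 < t)
    (h : R ^ (1 + α / 2) ≤ t) : t ^ ((2 - α) / (2 + α)) ≤ t / R ^ α := by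
  have h1 : R ^ α ≤ t ^ (2 * α / (2 + α)) := by
    calc R ^ α = (R ^ (1 + α / 2)) ^ (2 * α / (2 + α)) := by
          rw [← Real.rpow_mul hR.le]
          congr 1
          field_simp
      _ ≤ _ := by gcongr
  rw [le_div_iff₀ (by positivity)]
  calc t ^ ((2 - α) / (2 + α)) * R ^ α
      ≤ t ^ ((2 - α) / (2 + α)) * t ^ (2 * α / (2 + α)) := by gcongr
    _ = t := by
        rw [← Real.rpow_add ht, ← add_div, show 2 - α + 2 * α = 2 + α by ring,
          div_self (by positivity), Real.rpow_one]

/-- After the transition time, the Gaussian rate at scale `R` is at most the sublinear rate. -/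
theorem sq_div_le_rpow_of_le (hα : 0 < α) (hR : 0 < R) (ht : 0 < t)
    (h : R ^ (1 + α / 2) ≤ t) : R ^ 2 / t ≤ t ^ ((2 - α) / (2 + α)) := by
  rw [div_le_iff₀ ht]
  calc R ^ 2 = (R ^ (1 + α / 2)) ^ (4 / (2 + α)) := by
        rw [← Real.rpow_mul hR.le, ← Real.rpow_natCast]
        congr 1
        push_cast
        field_simp
        norm_num
    _ ≤ t ^ (4 / (2 + α)) := by gcongr
    _ = t ^ ((2 - α) / (2 + α)) * t := by
        rw [← Real.rpow_add_one ht.ne']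
        congr 1
        field_simp
        ring

end TransitionTime

theorem stmt_0 (d : ℕ) (hd : 1 ≤ d) (α : ℝ) (hα : α ∈ Set.Ioo (0:ℝ) 2)
    (p : ℝ → EuclideanSpace ℝ (Fin d) → EuclideanSpace ℝ (Fin d) → ℝ)
    (hp_nonneg : ∀ t, 0 < t → ∀ x y, 0 ≤ p t x y)
    (c₁ c₂ c₃ c₄ c₅ c₆ c₇ c₈ : ℝ)
    (hc₁ : 0 < c₁) (hc₂ : 0 < c₂) (hc₃ : 0 < c₃) (hc₄ : 0 < c₄)
    (hc₅ : 0 < c₅) (hc₆ : 0 < c₆) (hc₇ : 0 < c₇) (hc₈ : 0 < c₈)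
    (h_med : ∀ (x y : EuclideanSpace ℝ (Fin d)) (t : ℝ), 0 < t →
      t ≤ (1 + max ‖x‖ ‖y‖) ^ (1 + α / 2) →
      c₁ * t ^ (-(d : ℝ) / 2) *
        Real.exp (-(c₂ * (t / (1 + max ‖x‖ ‖y‖) ^ α + ‖x - y‖ ^ 2 / t))) ≤ p t x y ∧
      p t x y ≤ c₃ * t ^ (-(d : ℝ) / 2) *
        Real.exp (-(c₄ * (t / (1 + max ‖x‖ ‖y‖) ^ α + ‖x - y‖ ^ 2 / t))))
    (h_large : ∀ (x y : EuclideanSpace ℝ (Fin d)) (t : ℝ),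
      (1 + max ‖x‖ ‖y‖) ^ (1 + α / 2) < t →
      c₅ * Real.exp (-(c₆ * t ^ ((2 - α) / (2 + α)))) ≤ p t x y ∧
      p t x y ≤ c₇ * Real.exp (-(c₈ * t ^ ((2 - α) / (2 + α))))) :
    ∃ C₁ C₂ C₃ C₄ : ℝ, 0 < C₁ ∧ 0 < C₂ ∧ 0 < C₃ ∧ 0 < C₄ ∧
      ∀ (t : ℝ), 0 < t → ∀ (x y : EuclideanSpace ℝ (Fin d)),
        C₁ * t ^ (-(d : ℝ) / 2) * Real.exp (-(C₂ * ‖x - y‖ ^ 2 / t)) *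
          Real.exp (-(C₂ * min (t / (1 + max ‖x‖ ‖y‖) ^ α) (t ^ ((2 - α) / (2 + α)))))
          ≤ p t x y ∧
        p t x y ≤
          C₃ * t ^ (-(d : ℝ) / 2) * Real.exp (-(C₄ * ‖x - y‖ ^ 2 / t)) *
            Real.exp (-(C₄ * min (t / (1 + max ‖x‖ ‖y‖) ^ α) (t ^ ((2 - α) / (2 + α))))) := by
  obtain ⟨hα0, hα2⟩ := hα
  have hd0 : (0 : ℝ) < d := by exact_mod_cast hd
  set β := (2 - α) / (2 + α) with hβdef
  have hβ : 0 < β := div_pos (by linarith) (by linarith)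
  set k := (d : ℝ) / 2 / β with hkdef
  have hk : 0 < k := by positivity
  set K := (k / (c₈ / 2)) ^ k with hKdef
  have hK : 0 < K := by positivity
  refine ⟨min c₁ c₅, max c₂ c₆, max c₃ (c₇ * K), min c₄ (c₈ / 10), by positivity, by positivity,
    by positivity, by positivity, fun t ht x y => ?_⟩
  have hR : 1 ≤ 1 + max ‖x‖ ‖y‖ := by
    linarith [le_max_of_le_left (b := ‖x‖) (c := ‖y‖) (norm_nonneg x)]
  have hxy : ‖x - y‖ ≤ 2 * (1 + max ‖x‖ ‖y‖) := by
    linarith [norm_sub_le x y, le_max_left ‖x‖ ‖y‖, le_max_right ‖x‖ ‖y‖]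
  have hmed := h_med x y t ht
  have hlarge := h_large x y t
  set R := 1 + max ‖x‖ ‖y‖
  have hR0 : 0 < R := by linarith
  have hD0 : 0 ≤ ‖x - y‖ ^ 2 / t := by positivity
  simp only [mul_div_assoc]
  set D := ‖x - y‖ ^ 2 / t with hDdef
  have htd : 0 < t ^ (-(d : ℝ) / 2) := by positivity
  simp only [mul_assoc _ (Real.exp _) (Real.exp _), ← Real.exp_add]
  rcases le_or_gt t (R ^ (1 + α / 2)) with h | h
  · rw [min_eq_left (div_rpow_le_rpow_of_le hα0 hR0 ht h)]
    obtain ⟨hl, hu⟩ := hmed h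
    have hu0 : 0 ≤ t / R ^ α := by positivity
    set u := t / R ^ α
    refine ⟨le_trans ?_ hl, hu.trans ?_⟩
    · gcongr
      · exact min_le_left _ _
      · have := mul_le_mul_of_nonneg_right (le_max_left c₂ c₆) (add_nonneg hu0 hD0)
        linarith
    · gcongr
      · exact le_max_left _ _
      · have := mul_le_mul_of_nonneg_right (min_le_left c₄ (c₈ / 10)) (add_nonneg hu0 hD0)
        linarith
  · rw [min_eq_right (rpow_le_div_rpow_of_le hα0 hR0 ht h.le)]
    obtain ⟨hl, hu⟩ := hlarge h
    have ht1 : 1 ≤ t := (Real.one_le_rpow hR (by positivity)).trans h.le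
    have hs0 : 0 < t ^ β := by positivity
    have hDs : D ≤ 4 * t ^ β := by
      calc D ≤ (2 * R) ^ 2 / t := by rw [hDdef]; gcongr
        _ = 4 * (R ^ 2 / t) := by ring
        _ ≤ _ := by gcongr; exact sq_div_le_rpow_of_le hα0 hR0 ht h.le
    have htK : t ^ ((d : ℝ) / 2) ≤ K * Real.exp (c₈ / 2 * t ^ β) := by
      have := rpow_le_mul_exp hk (half_pos hc₈) hs0
      rwa [← Real.rpow_mul ht.le, hkdef, mul_div_cancel₀ _ hβ.ne'] at this
    set s := t ^ β
    refine ⟨le_trans ?_ hl, hu.trans ?_⟩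
    · have h1 : t ^ (-(d : ℝ) / 2) ≤ 1 :=
        Real.rpow_le_one_of_one_le_of_nonpos ht1 (by linarith)
      calc _ ≤ c₅ * 1 * Real.exp (-(max c₂ c₆ * D) + -(max c₂ c₆ * s)) := by
            gcongr
            exact min_le_right _ _
        _ ≤ _ := by
            rw [mul_one]
            gcongr
            have h2 : 0 ≤ max c₂ c₆ * D := by positivity
            have h3 := mul_le_mul_of_nonneg_right (le_max_right c₂ c₆) hs0.le
            linarith
    · have hC : 0 < min c₄ (c₈ / 10) := by positivity
      have hone : 1 ≤ t ^ (-(d : ℝ) / 2) * (K * Real.exp (c₈ / 2 * s)) := by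
        calc (1 : ℝ) = t ^ (-(d : ℝ) / 2) * t ^ ((d : ℝ) / 2) := by
              rw [← Real.rpow_add ht, neg_div, neg_add_cancel, Real.rpow_zero]
          _ ≤ _ := by gcongr
      calc c₇ * Real.exp (-(c₈ * s))
          ≤ c₇ * Real.exp (-(c₈ * s)) * (t ^ (-(d : ℝ) / 2) * (K * Real.exp (c₈ / 2 * s))) :=
            le_mul_of_one_le_right (by positivity) hone
        _ = c₇ * K * t ^ (-(d : ℝ) / 2) * Real.exp (-(c₈ * s) + c₈ / 2 * s) := by
            rw [Real.exp_add]; ring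
        _ ≤ _ := by
            have hexp : -(c₈ * s) + c₈ / 2 * s ≤
                -(min c₄ (c₈ / 10) * D) + -(min c₄ (c₈ / 10) * s) := by
              have h2 := mul_le_mul_of_nonneg_left hDs hC.le
              have h3 := mul_le_mul_of_nonneg_right (min_le_right c₄ (c₈ / 10)) hs0.le
              linarith
            have h4 := Real.exp_le_exp.mpr hexp
            gcongr ?_ * _ * ?_
            exact le_max_right _ _
end

section
/- Let d ≥ 2 be an integer and α ∈ (0,2). For x,y ∈ ℝ^d write M(x,y) := max(|x|,|y|). Suppose p : (0,∞) × ℝ^d × ℝ^d → [0,∞) is such that for each x,y the map t ↦ p(t,x,y) is measurable, and there exist constants C₃, C₄ > 0 such that p(t,x,y) ≤ C₃ t^{-d/2} exp(−C₄ |x−y|²/t) exp(−C₄ min(t/(1+M(x,y))^α, t^{(2−α)/(2+α)})) for all t > 0 and x,y ∈ ℝ^d. Then there exist constants C, c > 0 such that for all x,y ∈ ℝ^d with x ≠ y: if d ≥ 3, then ∫₀^∞ p(t,x,y) dt ≤ C |x−y|^{−(d−2)} exp(−c |x−y|/(1+M(x,y))^{α/2}); and if d = 2, then ∫₀^∞ p(t,x,y)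 dt ≤ C exp(−c |x−y|/(1+M(x,y))^{α/2}) (1 + max(log((1+M(x,y))^{α/2}/|x−y|), 0)). -/
open Real MeasureTheory

/-- A piecewise comparison for integrals over the positive half-line: constant near zero, `t⁻¹` in
the middle, and an integrable power at infinity. -/
theorem integral_Ioi_le_of_piecewise_bound {f : ℝ → ℝ} {R T a b k q : ℝ} (hR : 0 < R)
    (hRT : R ≤ T) (hq : 1 < q) (hf : ∀ t, 0 < t → 0 ≤ f t)
    (h_near : ∀ t, 0 < t → t ≤ R → f t ≤ a)
    (h_mid : ∀ t, R < t → t ≤ T → f t ≤ b * t⁻¹)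
    (h_far : ∀ t, T < t → f t ≤ k * t ^ (-q)) :
    ∫ t in Set.Ioi (0 : ℝ), f t ≤ a * R + b * log (T / R) + k * (T ^ (1 - q) / (q - 1)) := by
  have hT : 0 < T := hR.trans_le hRT
  set g₁ : ℝ → ℝ := (Set.Ioc 0 R).indicator fun _ => a with hg₁
  set g₂ : ℝ → ℝ := (Set.Ioc R T).indicator fun t => b * t⁻¹ with hg₂
  set g₃ : ℝ → ℝ := (Set.Ioi T).indicator fun t => k * t ^ (-q) with hg₃
  have h0 : (0 : ℝ) ∉ Set.uIcc R T := by
    rw [Set.uIcc_of_le hRT]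
    exact fun h => absurd h.1 (not_le.2 hR)
  have i₁ : Integrable g₁ (volume.restrict (Set.Ioi 0)) := by
    refine Integrable.restrict ?_
    exact (integrable_indicator_iff measurableSet_Ioc).2 (by simp)
  have i₂ : Integrable g₂ (volume.restrict (Set.Ioi 0)) := by
    refine Integrable.restrict ((integrable_indicator_iff measurableSet_Ioc).2 ?_)
    refine Integrable.const_mul ?_ b
    exact (intervalIntegrable_iff_integrableOn_Ioc_of_le hRT).1
      (intervalIntegral.intervalIntegrable_inv (fun t ht => fun h => h0 (h ▸ ht)) continuousOn_id)
  have i₃ : Integrable g₃ (volume.restrict (Set.Ioi 0)) := by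
    refine Integrable.restrict ((integrable_indicator_iff measurableSet_Ioi).2 ?_)
    exact Integrable.const_mul (integrableOn_Ioi_rpow_of_lt (by linarith) hT) k
  have e₁ : ∫ t in Set.Ioi (0 : ℝ), g₁ t = a * R := by
    rw [hg₁, setIntegral_indicator measurableSet_Ioc,
      Set.inter_eq_right.2 Set.Ioc_subset_Ioi_self]
    simp [hR.le, mul_comm]
  have e₂ : ∫ t in Set.Ioi (0 : ℝ), g₂ t = b * log (T / R) := by
    rw [hg₂, setIntegral_indicator measurableSet_Ioc, Set.inter_eq_right.2
      (Set.Ioc_subset_Ioi_self.trans (Set.Ioi_subset_Ioi hR.le)), integral_const_mul,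
      ← intervalIntegral.integral_of_le hRT, integral_inv h0]
  have e₃ : ∫ t in Set.Ioi (0 : ℝ), g₃ t = k * (T ^ (1 - q) / (q - 1)) := by
    rw [hg₃, setIntegral_indicator measurableSet_Ioi, Set.inter_eq_right.2
      (Set.Ioi_subset_Ioi hT.le), integral_const_mul,
      integral_Ioi_rpow_of_lt (by linarith) hT, show -q + 1 = 1 - q by ring,
      ← neg_sub q 1, div_neg, neg_div, neg_neg]
  have i₁₂ : Integrable (fun t => g₁ t + g₂ t) (volume.restrict (Set.Ioi 0)) := i₁.add i₂
  rw [← e₁, ← e₂, ← e₃, ← integral_add i₁ i₂, ← integral_add i₁₂ i₃]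
  refine integral_mono_of_nonneg ?_ (i₁₂.add i₃) ?_
  · filter_upwards [self_mem_ae_restrict measurableSet_Ioi] with t ht using hf t ht
  · filter_upwards [self_mem_ae_restrict measurableSet_Ioi] with t ht
    have ht : 0 < t := ht
    rcases le_or_gt t R with h | h
    · simpa [hg₁, hg₂, hg₃, ht, h, h.trans hRT] using h_near t ht h
    · rcases le_or_gt t T with h' | h'
      · simpa [hg₁, hg₂, hg₃, ht, h, h'] using h_mid t h h'
      · simpa [hg₁, hg₂, hg₃, ht, h, h'] using h_far t h'

theorem exp_neg_le_rpow_neg {s z : ℝ} (hs : 0 < s) (hz : 0 < z) :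
    exp (-z) ≤ s ^ s * z ^ (-s) := by
  have h := log_le_sub_one_of_pos (div_pos hz hs)
  rw [rpow_def_of_pos hs, rpow_def_of_pos hz, ← exp_add, exp_le_exp]
  rw [log_div hz.ne' hs.ne'] at h
  have h1 : (log z - log s) * s ≤ (z / s - 1) * s := by gcongr
  have h2 : z / s * s = z := div_mul_cancel₀ _ hs.ne'
  nlinarith

/-- The factor `t ^ (-s) * exp (-(B / t))` is bounded uniformly in `t`. -/
theorem rpow_neg_mul_exp_neg_div_le {s B t : ℝ} (hs : 0 < s) (hB : 0 < B) (ht : 0 < t) :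
    t ^ (-s) * exp (-(B / t)) ≤ s ^ s * B ^ (-s) := by
  calc t ^ (-s) * exp (-(B / t)) ≤ t ^ (-s) * (s ^ s * (B / t) ^ (-s)) := by
        gcongr
        exact exp_neg_le_rpow_neg hs (div_pos hB ht)
    _ = s ^ s * B ^ (-s) := by
        rw [div_rpow hB.le ht.le]
        have := (rpow_pos_of_pos ht (-s)).ne'
        field_simp

/-- The Gaussian and potential exponents together dominate the Agmon-type distance
`r / m ^ (α / 2)`. -/
theorem half_div_rpow_le_sq_div_add_min {α r m t : ℝ} (hα : α ∈ Set.Ioo (0 : ℝ) 2)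
    (hm : 1 ≤ m) (hr : 0 ≤ r) (hrm : r ≤ 2 * m) (ht : 0 < t) :
    r / m ^ (α / 2) / 2 ≤ r ^ 2 / t + min (t / m ^ α) (t ^ ((2 - α) / (2 + α))) := by
  obtain ⟨h0, h2⟩ := hα
  have hm0 : 0 < m := by linarith
  have hP : 0 < m ^ (α / 2) := rpow_pos_of_pos hm0 _
  have hβ : 0 ≤ (2 - α) / (2 + α) := div_nonneg (by linarith) (by linarith)
  have hsq : m ^ α = (m ^ (α / 2)) ^ 2 := by
    rw [← rpow_natCast, ← rpow_mul hm0.le]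
    norm_num
  have hamgm : r / m ^ (α / 2) / 2 ≤ r ^ 2 / t + t / m ^ α := by
    rw [hsq]
    set P := m ^ (α / 2)
    have h : r ^ 2 / t + t / P ^ 2 - r / P / 2
        = t * ((r / t - 1 / P) ^ 2 + 3 / 2 * (r / t) * (1 / P)) := by
      field_simp
      ring
    have : 0 ≤ t * ((r / t - 1 / P) ^ 2 + 3 / 2 * (r / t) * (1 / P)) := by positivity
    linarith
  rcases le_total t (m ^ (1 + α / 2)) with h | h
  · refine hamgm.trans_eq ?_
    rw [min_eq_left]
    have h1 : t ^ (1 - (2 - α) / (2 + α)) ≤ m ^ α := by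
      calc t ^ (1 - (2 - α) / (2 + α)) ≤ (m ^ (1 + α / 2)) ^ (1 - (2 - α) / (2 + α)) := by
            refine rpow_le_rpow ht.le h ?_
            rw [sub_nonneg, div_le_one (by linarith)]
            linarith
        _ = m ^ α := by
            rw [← rpow_mul hm0.le]
            congr 1
            field_simp
            ring
    rw [rpow_sub ht, rpow_one, div_le_iff₀ (rpow_pos_of_pos ht _)] at h1
    rw [div_le_iff₀ (rpow_pos_of_pos hm0 _)]
    linarith
  · rw [← min_add_add_left]
    refine le_min hamgm ?_
    have h1 : m / m ^ (α / 2) ≤ t ^ ((2 - α) / (2 + α)) := by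
      calc m / m ^ (α / 2) = (m ^ (1 + α / 2)) ^ ((2 - α) / (2 + α)) := by
            rw [← rpow_mul hm0.le, ← rpow_one_sub' hm0.le (by linarith)]
            congr 1
            field_simp
        _ ≤ t ^ ((2 - α) / (2 + α)) := rpow_le_rpow (by positivity) h hβ
    have h3 : r / m ^ (α / 2) / 2 ≤ m / m ^ (α / 2) := by
      rw [div_right_comm]
      gcongr
      linarith
    have : 0 ≤ r ^ 2 / t := by positivity
    linarith

theorem rpow_div_le_min_of_le {β S t : ℝ} (hβ : β ∈ Set.Icc (0 : ℝ) 1) (hS : 1 ≤ S)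
    (hSt : S ≤ t) : (t / S) ^ β ≤ min (t / S) (t ^ β) := by
  have hS0 : 0 < S := by linarith
  refine le_min ?_ ?_
  · exact rpow_le_self_of_one_le ((one_le_div hS0).2 hSt) hβ.2
  · exact rpow_le_rpow (div_nonneg (by linarith) hS0.le)
      (div_le_self (by linarith) hS) hβ.1

/-- Half of a heat-kernel exponent is traded for exponential decay in the Agmon-type distance. -/
theorem heat_kernel_bound_split {α r m t C₃ C₄ s : ℝ} (hα : α ∈ Set.Ioo (0 : ℝ) 2)
    (hm : 1 ≤ m) (hr : 0 ≤ r) (hrm : r ≤ 2 * m) (ht : 0 < t) (hC₃ : 0 < C₃) (hC₄ : 0 < C₄) :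
    C₃ * t ^ s * exp (-(C₄ * r ^ 2 / t)) *
        exp (-(C₄ * min (t / m ^ α) (t ^ ((2 - α) / (2 + α))))) ≤
      C₃ * exp (-(C₄ / 4 * r / m ^ (α / 2))) * (t ^ s * exp (-(C₄ / 2 * r ^ 2 / t)) *
        exp (-(C₄ / 2 * min (t / m ^ α) (t ^ ((2 - α) / (2 + α)))))) := by
  have h := half_div_rpow_le_sq_div_add_min hα hm hr hrm ht
  set w := min (t / m ^ α) (t ^ ((2 - α) / (2 + α)))
  have hexp : exp (-(C₄ * r ^ 2 / t)) * exp (-(C₄ * w)) ≤ exp (-(C₄ / 4 * r / m ^ (α / 2))) *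
      (exp (-(C₄ / 2 * r ^ 2 / t)) * exp (-(C₄ / 2 * w))) := by
    rw [← exp_add, ← exp_add, ← exp_add, exp_le_exp]
    simp only [mul_div_assoc]
    nlinarith
  have hts : 0 ≤ C₃ * t ^ s := by positivity
  linarith [mul_le_mul_of_nonneg_left hexp hts]

theorem stmt_1 (d : ℕ) (hd : 2 ≤ d) (α : ℝ) (hα : α ∈ Set.Ioo (0:ℝ) 2)
    (p : ℝ → EuclideanSpace ℝ (Fin d) → EuclideanSpace ℝ (Fin d) → ℝ)
    (hp_nonneg : ∀ t, 0 < t → ∀ x y, 0 ≤ p t x y)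
    (hp_meas : ∀ x y, Measurable (fun t => p t x y))
    (C₃ C₄ : ℝ) (hC₃ : 0 < C₃) (hC₄ : 0 < C₄)
    (h_upper : ∀ (t : ℝ), 0 < t → ∀ (x y : EuclideanSpace ℝ (Fin d)),
      p t x y ≤ C₃ * t ^ (-(d : ℝ) / 2) * Real.exp (-(C₄ * ‖x - y‖ ^ 2 / t)) *
        Real.exp (-(C₄ * min (t / (1 + max ‖x‖ ‖y‖) ^ α) (t ^ ((2 - α) / (2 + α)))))) :
    ∃ C c : ℝ, 0 < C ∧ 0 < c ∧
      ∀ (x y : EuclideanSpace ℝ (Fin d)), x ≠ y →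
        (3 ≤ d →
          (∫ t in Set.Ioi (0:ℝ), p t x y) ≤
            C * ‖x - y‖ ^ (-((d : ℝ) - 2)) *
              Real.exp (-(c * ‖x - y‖ / (1 + max ‖x‖ ‖y‖) ^ (α / 2)))) ∧
        (d = 2 →
          (∫ t in Set.Ioi (0:ℝ), p t x y) ≤
            C * Real.exp (-(c * ‖x - y‖ / (1 + max ‖x‖ ‖y‖) ^ (α / 2))) *
              (1 + max (Real.log ((1 + max ‖x‖ ‖y‖) ^ (α / 2) / ‖x - y‖)) 0)) := by
  have hm1 : ∀ x y : EuclideanSpace ℝ (Fin d), 1 ≤ 1 + max ‖x‖ ‖y‖ := fun x y =>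
    le_add_of_nonneg_right ((norm_nonneg x).trans (le_max_left _ _))
  have hrm : ∀ x y : EuclideanSpace ℝ (Fin d), ‖x - y‖ ≤ 2 * (1 + max ‖x‖ ‖y‖) := fun x y => by
    linarith [norm_sub_le x y, le_max_left ‖x‖ ‖y‖, le_max_right ‖x‖ ‖y‖]
  have h_split := fun t (ht : 0 < t) x y => (h_upper t ht x y).trans
    (heat_kernel_bound_split hα (hm1 x y) (norm_nonneg (x - y)) (hrm x y) ht hC₃ hC₄)
  have hA : 0 < C₄ / 2 := by linarith
  set A := C₄ / 2
  rcases hd.eq_or_lt with rfl | hd3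
  · obtain ⟨hα0, hα2⟩ := hα
    set β := (2 - α) / (2 + α)
    have hβ : 0 < β := div_pos (by linarith) (by linarith)
    have hβ1 : β ≤ 1 := (div_le_one (by linarith)).2 (by linarith)
    refine ⟨C₃ * (A⁻¹ + 2 + A⁻¹ / β), C₄ / 4, by positivity, by positivity,
      fun x y hxy => ⟨fun h => by omega, fun _ => ?_⟩⟩
    have hr : 0 < ‖x - y‖ := norm_pos_iff.2 (sub_ne_zero.2 hxy)
    have hm := hm1 x y
    have hsp := fun t ht => h_split t ht x y
    set r := ‖x - y‖
    set m := 1 + max ‖x‖ ‖y‖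
    have hm0 : 0 < m := by linarith
    set E := exp (-(C₄ / 4 * r / m ^ (α / 2)))
    have hE : 0 < E := exp_pos _
    have hCE : 0 < C₃ * E := mul_pos hC₃ hE
    have hS1 : 1 ≤ m ^ α := one_le_rpow hm hα0.le
    have hS0 : 0 < m ^ α := by linarith
    set w : ℝ → ℝ := fun t => min (t / m ^ α) (t ^ β)
    have hw : ∀ t, 0 < t → 0 ≤ w t := fun t ht => by positivity
    have hsp' : ∀ t, 0 < t → p t x y ≤
        C₃ * E * (t⁻¹ * exp (-(A * r ^ 2 / t)) * exp (-(A * w t))) := fun t ht => by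
      have := hsp t ht
      norm_num [rpow_neg_one] at this ⊢
      exact this
    have hone : ∀ z : ℝ, 0 ≤ z → exp (-z) ≤ 1 := fun z hz => exp_le_one_iff.2 (by linarith)
    have key := integral_Ioi_le_of_piecewise_bound (f := fun t => p t x y) (R := r ^ 2)
      (T := max (m ^ α) (r ^ 2)) (a := C₃ * E * (A * r ^ 2)⁻¹) (b := C₃ * E)
      (k := C₃ * E * (A⁻¹ * (m ^ α) ^ β)) (q := 1 + β) (by positivity) (le_max_right _ _)
      (by linarith) (fun t ht => hp_nonneg t ht x y) ?_ ?_ ?_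
    · refine key.trans ?_
      have hlog : log (max (m ^ α) (r ^ 2) / r ^ 2) =
          2 * max (log (m ^ (α / 2) / r)) 0 := by
        have hsq : m ^ α / r ^ 2 = (m ^ (α / 2) / r) ^ 2 := by
          rw [div_pow, ← rpow_natCast (m ^ (α / 2)), ← rpow_mul hm0.le]
          norm_num
        have hpos : 0 < m ^ (α / 2) / r := by positivity
        rcases le_total (r ^ 2) (m ^ α) with h | h
        · rw [max_eq_left h, hsq, log_pow, max_eq_left]
          · norm_num
          · refine log_nonneg ?_
            rw [← one_le_div (by positivity), hsq] at h
            exact (one_le_sq_iff₀ hpos.le).1 h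
        · rw [max_eq_right h, div_self (by positivity), log_one, max_eq_right, mul_zero]
          refine log_nonpos hpos.le ?_
          rw [← div_le_one (by positivity), hsq] at h
          exact (sq_le_one_iff₀ hpos.le).1 h
      have hnear : C₃ * E * (A * r ^ 2)⁻¹ * r ^ 2 = C₃ * E * A⁻¹ := by
        field_simp
      have hfar : (m ^ α) ^ β * max (m ^ α) (r ^ 2) ^ (-β) ≤ 1 := by
        rw [rpow_neg (by positivity), ← div_eq_mul_inv, div_le_one (by positivity)]
        exact rpow_le_rpow hS0.le (le_max_left _ _) hβ.le
      have hfar' : C₃ * E * (A⁻¹ * (m ^ α) ^ β) *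
          (max (m ^ α) (r ^ 2) ^ (1 - (1 + β)) / (1 + β - 1)) ≤ C₃ * E * (A⁻¹ / β) := by
        rw [show 1 - (1 + β) = -β by ring, show 1 + β - 1 = β by ring]
        calc _ = C₃ * E * (A⁻¹ / β) * ((m ^ α) ^ β * max (m ^ α) (r ^ 2) ^ (-β)) := by ring
          _ ≤ C₃ * E * (A⁻¹ / β) := mul_le_of_le_one_right (by positivity) hfar
      rw [hlog, hnear]
      set L := max (log (m ^ (α / 2) / r)) 0
      have hL : 0 ≤ L := le_max_right _ _
      have h1 : 0 ≤ C₃ * E * (A⁻¹ + A⁻¹ / β) * L := by positivity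
      nlinarith
    · intro t ht _
      refine (hsp' t ht).trans (mul_le_mul_of_nonneg_left ?_ hCE.le)
      have h := rpow_neg_mul_exp_neg_div_le one_pos (show 0 < A * r ^ 2 by positivity) ht
      simp only [rpow_neg_one, one_rpow, one_mul] at h
      exact (mul_le_of_le_one_right (by positivity) (hone _ (mul_nonneg hA.le (hw t ht)))).trans h
    · intro t ht _
      have ht0 : 0 < t := lt_trans (by positivity) ht
      refine (hsp' t ht0).trans (mul_le_mul_of_nonneg_left ?_ hCE.le)
      exact (mul_le_of_le_one_right (by positivity) (hone _ (mul_nonneg hA.le (hw t ht0)))).trans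
        (mul_le_of_le_one_right (by positivity) (hone _ (by positivity)))
    · intro t ht
      have hSt : m ^ α < t := (le_max_left _ _).trans_lt ht
      have ht0 : 0 < t := hS0.trans hSt
      refine (hsp' t ht0).trans ?_
      rw [mul_assoc (C₃ * E)]
      refine mul_le_mul_of_nonneg_left ?_ hCE.le
      have hv : 0 < A * (t / m ^ α) ^ β := by positivity
      have h1 : exp (-(A * w t)) ≤ (A * (t / m ^ α) ^ β)⁻¹ := by
        have h := exp_neg_le_rpow_neg one_pos hv
        simp only [rpow_neg_one, one_rpow, one_mul] at h
        refine le_trans (exp_le_exp.2 (neg_le_neg ?_)) h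
        exact mul_le_mul_of_nonneg_left
          (rpow_div_le_min_of_le ⟨hβ.le, hβ1⟩ hS1 hSt.le) hA.le
      calc t⁻¹ * exp (-(A * r ^ 2 / t)) * exp (-(A * w t))
          ≤ t⁻¹ * 1 * (A * (t / m ^ α) ^ β)⁻¹ := by
            gcongr
            exact hone _ (by positivity)
        _ = A⁻¹ * (m ^ α) ^ β * t ^ (-(1 + β)) := by
            rw [div_rpow ht0.le hS0.le, rpow_neg ht0.le, rpow_add ht0, rpow_one]
            field_simp
  · have hd3' : (3 : ℝ) ≤ d := by exact_mod_cast hd3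
    set s : ℝ := d / 2 with hs_def
    have hs : 1 < s := by linarith
    have hs0 : 0 < s := by linarith
    have hs1 : 0 < s - 1 := by linarith
    refine ⟨C₃ * (s ^ s * A ^ (-s) + 1 / (s - 1)), C₄ / 4, by positivity, by positivity,
      fun x y hxy => ⟨fun _ => ?_, fun h => by omega⟩⟩
    have hr : 0 < ‖x - y‖ := norm_pos_iff.2 (sub_ne_zero.2 hxy)
    have hm := hm1 x y
    have hsp := fun t ht => h_split t ht x y
    set r := ‖x - y‖
    set m := 1 + max ‖x‖ ‖y‖
    have hm0 : 0 < m := by linarith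
    set E := exp (-(C₄ / 4 * r / m ^ (α / 2)))
    have hE : 0 < E := exp_pos _
    have hCE : 0 < C₃ * E := mul_pos hC₃ hE
    have hsp' : ∀ t, 0 < t → p t x y ≤ C₃ * E * (t ^ (-s) * exp (-(A * r ^ 2 / t))) :=
      fun t ht => by
        refine (hsp t ht).trans (mul_le_mul_of_nonneg_left ?_ hCE.le)
        rw [neg_div]
        refine mul_le_of_le_one_right (by positivity) (exp_le_one_iff.2 ?_)
        rw [neg_nonpos]
        positivity
    have key := integral_Ioi_le_of_piecewise_bound (f := fun t => p t x y) (R := r ^ 2)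
      (T := r ^ 2) (a := C₃ * E * (s ^ s * (A * r ^ 2) ^ (-s))) (b := 0)
      (k := C₃ * E) (q := s) (by positivity) le_rfl hs (fun t ht => hp_nonneg t ht x y)
      ?_ (fun t h h' => absurd h' (not_le.2 h)) ?_
    · refine key.trans_eq ?_
      have hpow : (r ^ 2) ^ (1 - s) = r ^ (-((d : ℝ) - 2)) := by
        rw [← rpow_natCast, ← rpow_mul hr.le]
        congr 1
        push_cast
        rw [hs_def]
        ring
      have hpow' : (r ^ 2) ^ (-s) * r ^ 2 = (r ^ 2) ^ (1 - s) := by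
        rw [sub_eq_neg_add, rpow_add (by positivity), rpow_one]
      rw [mul_rpow hA.le (by positivity), ← hpow, ← hpow']
      ring
    · intro t ht _
      exact (hsp' t ht).trans (mul_le_mul_of_nonneg_left
        (rpow_neg_mul_exp_neg_div_le hs0 (by positivity) ht) hCE.le)
    · intro t ht
      have ht0 : 0 < t := lt_trans (by positivity) ht
      refine (hsp' t ht0).trans (mul_le_mul_of_nonneg_left ?_ hCE.le)
      refine mul_le_of_le_one_right (by positivity) (exp_le_one_iff.2 ?_)
      rw [neg_nonpos]
      positivity
end

section
/- Let d ≥ 1 be an integer and α ∈ (2,∞). There exists a constant C > 0 such that for every x ∈ ℝ^d and every s with 0 < s ≤ (1+|x|)², one has ∫_{ℝ^d} s^{-d/2} (1+|z|)^{-α} exp(−|x−z|²/s) dz ≤ C (1 + 𝟙_{d=α} · log(2+|x|)) / (1+|x|)^{min(d,α)}, where 𝟙_{d=α} equals 1 if α = d and 0 otherwise. -/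
open Real MeasureTheory

lemma Real.exists_rpow_mul_exp_neg_le {p c : ℝ} (hp : 0 < p) (hc : 0 < c) :
    ∃ K : ℝ, 0 < K ∧ ∀ t : ℝ, 0 ≤ t → t ^ p * exp (-(c * t)) ≤ K := by
  refine ⟨(p / c) ^ p, by positivity, fun t ht ↦ ?_⟩
  have h1 : c * t / p ≤ exp (c * t / p) := by linarith [add_one_le_exp (c * t / p)]
  have h2 : t ≤ p / c * exp (c * t / p) := by
    calc t = p / c * (c * t / p) := by field_simp
      _ ≤ _ := by gcongr
  have h3 : t ^ p ≤ (p / c) ^ p * exp (c * t) := by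
    calc t ^ p ≤ (p / c * exp (c * t / p)) ^ p := by gcongr
      _ = (p / c) ^ p * exp (c * t) := by
        rw [mul_rpow (by positivity) (by positivity), ← exp_mul]
        congr 2
        field_simp
  calc t ^ p * exp (-(c * t)) ≤ (p / c) ^ p * exp (c * t) * exp (-(c * t)) := by gcongr
    _ = (p / c) ^ p := by rw [mul_assoc, ← exp_add]; simp

lemma exists_integral_rpow_sub_one_le (p : ℝ) :
    ∃ C : ℝ, 0 < C ∧ ∀ R : ℝ, 1 ≤ R →
      ∫ u in (1 : ℝ)..(1 + R), u ^ (p - 1) ≤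
        C * (1 + if p = 0 then log (1 + R) else 0) * R ^ max p 0 := by
  have h0 : ∀ R : ℝ, 1 ≤ R → (0 : ℝ) ∉ Set.uIcc 1 (1 + R) := fun R hR h ↦ by
    rw [Set.uIcc_of_le (by linarith)] at h
    linarith [h.1]
  rcases lt_trichotomy p 0 with hp | rfl | hp
  · refine ⟨(-p)⁻¹, by simpa using hp, fun R hR ↦ ?_⟩
    rw [integral_rpow (.inr ⟨by linarith, h0 R hR⟩), if_neg hp.ne, max_eq_right hp.le]
    have : 0 ≤ (1 + R) ^ p := by positivity
    simp only [sub_add_cancel, one_rpow, add_zero, mul_one, rpow_zero]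
    rw [← neg_div_neg_eq, div_eq_mul_inv]
    exact mul_le_of_le_one_left (by simpa using hp.le) (by linarith)
  · refine ⟨1, one_pos, fun R hR ↦ ?_⟩
    have : ∫ u in (1 : ℝ)..(1 + R), u ^ ((0 : ℝ) - 1) = log (1 + R) := by
      simp only [zero_sub, rpow_neg_one]
      rw [integral_inv (h0 R hR), div_one]
    rw [this]
    simp
  · refine ⟨2 ^ p / p, by positivity, fun R hR ↦ ?_⟩
    rw [integral_rpow (.inl (by linarith)), if_neg hp.ne', max_eq_left hp.le]
    have h : (1 + R) ^ p ≤ 2 ^ p * R ^ p := by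
      rw [← mul_rpow (by positivity) (by linarith)]
      gcongr
      linarith
    simp only [sub_add_cancel, one_rpow, add_zero, mul_one]
    rw [div_mul_eq_mul_div]
    gcongr
    linarith

section NormedSpace

variable {E : Type*} [NormedAddCommGroup E] [NormedSpace ℝ E] [FiniteDimensional ℝ E]
  [MeasurableSpace E] [BorelSpace E] (μ : Measure E) [μ.IsAddHaarMeasure]

lemma integrableOn_closedBall_one_add_norm_rpow (a R : ℝ) :
    IntegrableOn (fun z : E ↦ (1 + ‖z‖) ^ a) (Metric.closedBall 0 R) μ := by
  refine ContinuousOn.integrableOn_compact (isCompact_closedBall 0 R) ?_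
  refine ContinuousOn.rpow_const (by fun_prop) fun z _ ↦ .inl ?_
  positivity

lemma setIntegral_closedBall_one_add_norm_rpow_le [Nontrivial E] (a : ℝ) {R : ℝ} (hR : 0 ≤ R) :
    ∫ z in Metric.closedBall (0 : E) R, (1 + ‖z‖) ^ (-a) ∂μ ≤
      Module.finrank ℝ E * μ.real (Metric.ball 0 1) *
        ∫ u in (1 : ℝ)..(1 + R), u ^ (Module.finrank ℝ E - a - 1) := by
  set n := Module.finrank ℝ E with hn
  have hn1 : 1 ≤ n := Module.finrank_pos
  let f : ℝ → ℝ := (Set.Iic R).indicator fun r ↦ (1 + r) ^ (-a)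
  have h1 : ∫ z in Metric.closedBall (0 : E) R, (1 + ‖z‖) ^ (-a) ∂μ = ∫ z, f ‖z‖ ∂μ := by
    rw [← integral_indicator Metric.isClosed_closedBall.measurableSet]
    congr 1 with z
    simp [f, Set.indicator]
  have h2 : ∫ r in Set.Ioi (0 : ℝ), r ^ (n - 1) • f r =
      ∫ r in (0 : ℝ)..R, r ^ (n - 1) * (1 + r) ^ (-a) := by
    rw [intervalIntegral.integral_of_le hR, ← Set.Ioi_inter_Iic,
      ← setIntegral_indicator measurableSet_Iic]
    congr 1 with r
    by_cases hr : r ≤ R <;> simp [f, hr]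
  have h3 : ∫ r in (0 : ℝ)..R, r ^ (n - 1) * (1 + r) ^ (-a) ≤
      ∫ r in (0 : ℝ)..R, (1 + r) ^ ((n : ℝ) - a - 1) := by
    have hc (b : ℝ) : ContinuousOn (fun r : ℝ ↦ (1 + r) ^ b) (Set.uIcc 0 R) := by
      refine ContinuousOn.rpow_const (by fun_prop) fun r hr ↦ .inl ?_
      rw [Set.uIcc_of_le hR] at hr
      linarith [hr.1]
    refine intervalIntegral.integral_mono_on hR ?_ (hc _).intervalIntegrable fun r hr ↦ ?_
    · exact ((by fun_prop : ContinuousOn (fun r : ℝ ↦ r ^ (n - 1)) _).mul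
        (hc _)).intervalIntegrable
    · have hr0 := hr.1
      calc r ^ (n - 1) * (1 + r) ^ (-a) ≤ (1 + r) ^ (n - 1) * (1 + r) ^ (-a) := by
            gcongr
            linarith
        _ = (1 + r) ^ ((n : ℝ) - a - 1) := by
            rw [← rpow_natCast, ← rpow_add (by linarith), Nat.cast_sub hn1]
            congr 1
            push_cast
            ring
  rw [h1, integral_fun_norm_addHaar, h2, ← hn, nsmul_eq_mul, smul_eq_mul, mul_assoc]
  rw [intervalIntegral.integral_comp_add_left fun u : ℝ ↦ u ^ ((n : ℝ) - a - 1), add_zero] at h3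
  gcongr

lemma exists_setIntegral_closedBall_one_add_norm_rpow_le [Nontrivial E] (a : ℝ) :
    ∃ C : ℝ, 0 < C ∧ ∀ R : ℝ, 1 ≤ R →
      ∫ z in Metric.closedBall (0 : E) R, (1 + ‖z‖) ^ (-a) ∂μ ≤
        C * (1 + if a = Module.finrank ℝ E then log (1 + R) else 0) *
          R ^ max (Module.finrank ℝ E - a) 0 := by
  obtain ⟨C, hC, h⟩ := exists_integral_rpow_sub_one_le (Module.finrank ℝ E - a)
  have hn : 0 < Module.finrank ℝ E := Module.finrank_pos
  have hμ : 0 < μ.real (Metric.ball (0 : E) 1) :=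
    ENNReal.toReal_pos (Metric.measure_ball_pos μ 0 one_pos).ne' measure_ball_lt_top.ne
  refine ⟨Module.finrank ℝ E * μ.real (Metric.ball 0 1) * C, by positivity, fun R hR ↦ ?_⟩
  refine (setIntegral_closedBall_one_add_norm_rpow_le μ a (by linarith)).trans ?_
  have := h R hR
  simp only [sub_eq_zero, eq_comm (b := a)] at this
  rw [mul_assoc _ C, mul_assoc _ (C * _)]
  gcongr

end NormedSpace

section InnerProductSpace

variable {V : Type*} [NormedAddCommGroup V] [InnerProductSpace ℝ V] [FiniteDimensional ℝ V]

lemma exists_heatKernel_le [Nontrivial V] :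
    ∃ K : ℝ, 0 < K ∧ ∀ (y : V) (s R : ℝ), 0 < s → 0 < R → R ≤ 2 * ‖y‖ →
      s ^ (-(Module.finrank ℝ V : ℝ) / 2) * exp (-(‖y‖ ^ 2 / s)) ≤
        K * R ^ (-(Module.finrank ℝ V : ℝ)) := by
  have hn : (0 : ℝ) < Module.finrank ℝ V := by exact_mod_cast Module.finrank_pos
  set n : ℝ := (Module.finrank ℝ V : ℝ)
  obtain ⟨K, hK, h⟩ := exists_rpow_mul_exp_neg_le (p := n / 2) (c := 1 / 4)
    (by positivity) (by positivity)
  refine ⟨K, hK, fun y s R hs hR hy ↦ ?_⟩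
  have hs_eq : s ^ (-n / 2) = R ^ (-n) * (R ^ 2 / s) ^ (n / 2) := by
    rw [div_rpow (by positivity) hs.le, ← rpow_natCast R 2, ← rpow_mul hR.le, mul_div_assoc',
      ← rpow_add hR, neg_div, rpow_neg hs.le]
    simp [mul_div_cancel₀]
  calc s ^ (-n / 2) * exp (-(‖y‖ ^ 2 / s))
      ≤ s ^ (-n / 2) * exp (-(1 / 4 * (R ^ 2 / s))) := by
        gcongr
        rw [mul_div_assoc']
        gcongr
        nlinarith
    _ = R ^ (-n) * ((R ^ 2 / s) ^ (n / 2) * exp (-(1 / 4 * (R ^ 2 / s)))) := by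
        rw [hs_eq, mul_assoc]
    _ ≤ R ^ (-n) * K := by
        gcongr
        exact h _ (by positivity)
    _ = _ := mul_comm _ _

variable [MeasurableSpace V] [BorelSpace V]

lemma integral_heatKernel (x : V) {s : ℝ} (hs : 0 < s) :
    ∫ z : V, s ^ (-(Module.finrank ℝ V : ℝ) / 2) * exp (-(‖x - z‖ ^ 2 / s)) =
      π ^ ((Module.finrank ℝ V : ℝ) / 2) := by
  have h := GaussianFourier.integral_rexp_neg_mul_sq_norm (V := V) (inv_pos.2 hs)
  rw [← integral_sub_left_eq_self _ volume x] at h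
  simp only [neg_mul, inv_mul_eq_div] at h
  rw [integral_const_mul, h, div_inv_eq_mul, mul_rpow pi_pos.le hs.le, mul_left_comm,
    ← rpow_add hs]
  ring_nf
  simp

lemma integrable_heatKernel (x : V) {s : ℝ} (hs : 0 < s) :
    Integrable fun z : V ↦ s ^ (-(Module.finrank ℝ V : ℝ) / 2) * exp (-(‖x - z‖ ^ 2 / s)) :=
  .of_integral_ne_zero (by rw [integral_heatKernel x hs]; positivity)

/-- Convolving the decaying weight `(1 + ‖z‖) ^ (-a)` with a heat kernel of arbitrary scale. -/
theorem exists_integral_heatKernel_mul_one_add_norm_rpow_le [Nontrivial V] {a : ℝ} (ha : 0 ≤ a) :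
    ∃ C : ℝ, 0 < C ∧ ∀ (x : V) (s : ℝ), 0 < s →
      (∫ z : V, s ^ (-(Module.finrank ℝ V : ℝ) / 2) * (1 + ‖z‖) ^ (-a) *
          exp (-(‖x - z‖ ^ 2 / s))) ≤
        C * (1 + if a = Module.finrank ℝ V then log (2 + ‖x‖) else 0) /
          (1 + ‖x‖) ^ min (Module.finrank ℝ V : ℝ) a := by
  obtain ⟨K, hK, hker⟩ := exists_heatKernel_le (V := V)
  obtain ⟨B, hB, hball⟩ :=
    exists_setIntegral_closedBall_one_add_norm_rpow_le (volume : Measure V) a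
  set n : ℝ := (Module.finrank ℝ V : ℝ)
  refine ⟨2 ^ a * π ^ (n / 2) + K * B, by positivity, fun x s hs ↦ ?_⟩
  set R := 1 + ‖x‖ with hR_def
  have hR : 1 ≤ R := by simp [R]
  have hR0 : 0 < R := by linarith
  set L : ℝ := 1 + if a = n then log (2 + ‖x‖) else 0 with hL
  have hL1 : 1 ≤ L := by
    have : 0 ≤ log (2 + ‖x‖) := log_nonneg (by linarith [norm_nonneg x])
    rw [hL]
    split_ifs <;> linarith
  have hball' : ∫ z in Metric.closedBall (0 : V) R, (1 + ‖z‖) ^ (-a) ≤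
      B * L * R ^ max (n - a) 0 := by
    convert hball R hR using 6
    rw [hR_def]
    ring
  let G : V → ℝ := fun z ↦ s ^ (-n / 2) * exp (-(‖x - z‖ ^ 2 / s))
  let W : V → ℝ := (Metric.closedBall (0 : V) R).indicator fun z ↦ (1 + ‖z‖) ^ (-a)
  have hG : Integrable G := integrable_heatKernel x hs
  have hW : Integrable W := (integrable_indicator_iff Metric.isClosed_closedBall.measurableSet).2
    (integrableOn_closedBall_one_add_norm_rpow _ _ _)
  have hW0 (z : V) : 0 ≤ W z := Set.indicator_nonneg (fun z _ ↦ by positivity) z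
  have hpt (z : V) : s ^ (-n / 2) * (1 + ‖z‖) ^ (-a) * exp (-(‖x - z‖ ^ 2 / s)) ≤
      2 ^ a * R ^ (-a) * G z + K * R ^ (-n) * W z := by
    have hG0 : 0 ≤ G z := by positivity
    rw [mul_right_comm, mul_comm]
    change (1 + ‖z‖) ^ (-a) * G z ≤ _
    rcases le_or_gt R (2 * (1 + ‖z‖)) with hz | hz
    · have : (1 + ‖z‖) ^ (-a) ≤ 2 ^ a * R ^ (-a) := by
        calc (1 + ‖z‖) ^ (-a) ≤ (R / 2) ^ (-a) :=
              rpow_le_rpow_of_nonpos (by positivity) (by linarith) (by linarith)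
          _ = 2 ^ a * R ^ (-a) := by
              rw [div_rpow hR0.le zero_le_two, rpow_neg zero_le_two, div_inv_eq_mul, mul_comm]
      have h2 : 0 ≤ K * R ^ (-n) * W z := mul_nonneg (by positivity) (hW0 z)
      linarith [mul_le_mul_of_nonneg_right this hG0]
    · have hWz : W z = (1 + ‖z‖) ^ (-a) :=
        Set.indicator_of_mem (by simpa using by linarith [norm_nonneg z]) _
      have hGz : G z ≤ K * R ^ (-n) :=
        hker (x - z) s R hs hR0 (by linarith [norm_sub_norm_le x z])
      have h1 : 0 ≤ 2 ^ a * R ^ (-a) * G z := by positivity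
      have h2 : (1 + ‖z‖) ^ (-a) * G z ≤ (1 + ‖z‖) ^ (-a) * (K * R ^ (-n)) := by gcongr
      rw [hWz]
      linarith
  calc ∫ z : V, s ^ (-n / 2) * (1 + ‖z‖) ^ (-a) * exp (-(‖x - z‖ ^ 2 / s))
      ≤ ∫ z : V, (2 ^ a * R ^ (-a) * G z + K * R ^ (-n) * W z) :=
        integral_mono_of_nonneg (.of_forall fun z ↦ by positivity)
          ((hG.const_mul _).add (hW.const_mul _)) (.of_forall hpt)
    _ = 2 ^ a * R ^ (-a) * π ^ (n / 2) +
          K * R ^ (-n) * ∫ z in Metric.closedBall (0 : V) R, (1 + ‖z‖) ^ (-a) := by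
        rw [integral_add (hG.const_mul _) (hW.const_mul _), integral_const_mul _ G,
          integral_const_mul _ W, integral_indicator Metric.isClosed_closedBall.measurableSet,
          integral_heatKernel x hs]
    _ ≤ 2 ^ a * R ^ (-min n a) * π ^ (n / 2) * L +
          K * R ^ (-n) * (B * L * R ^ max (n - a) 0) := by
        refine add_le_add ((le_mul_of_one_le_right (by positivity) hL1).trans' ?_) (by gcongr)
        gcongr
        exact min_le_right n a
    _ = (2 ^ a * π ^ (n / 2) + K * B) * L / R ^ min n a := by
        have : R ^ (-n) * R ^ max (n - a) 0 = R ^ (-min n a) := by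
          rw [← rpow_add hR0]
          congr 1
          rcases le_total n a with h | h
          · rw [max_eq_right (by linarith), min_eq_left h, add_zero]
          · rw [max_eq_left (by linarith), min_eq_right h]
            ring
        rw [div_eq_mul_inv _ (R ^ min n a), ← rpow_neg hR0.le, ← this]
        ring

end InnerProductSpace

theorem stmt_3 (d : ℕ) (hd : 1 ≤ d) (α : ℝ) (hα : 2 < α) :
    ∃ C : ℝ, 0 < C ∧
      ∀ (x : EuclideanSpace ℝ (Fin d)) (s : ℝ), 0 < s → s ≤ (1 + ‖x‖) ^ 2 →
        (∫ z : EuclideanSpace ℝ (Fin d),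
            s ^ (-(d : ℝ) / 2) * (1 + ‖z‖) ^ (-α) * Real.exp (-(‖x - z‖ ^ 2 / s))) ≤
          C * (1 + (if α = (d : ℝ) then Real.log (2 + ‖x‖) else 0)) /
            (1 + ‖x‖) ^ (min (d : ℝ) α) := by
  have : Nontrivial (EuclideanSpace ℝ (Fin d)) :=
    Module.nontrivial_of_finrank_pos (R := ℝ) (by rw [finrank_euclideanSpace_fin]; lia)
  obtain ⟨C, hC, h⟩ := exists_integral_heatKernel_mul_one_add_norm_rpow_le
    (V := EuclideanSpace ℝ (Fin d)) (a := α) (by linarith)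
  rw [finrank_euclideanSpace_fin] at h
  exact ⟨C, hC, fun x s hs _ ↦ h x s hs⟩
end

section
/- Let d ≥ 1 be an integer and α ∈ (2,∞). There exists a constant C > 0 such that for every x ∈ ℝ^d and every s ≥ (1+|x|)², one has ∫_{ℝ^d} s^{-d/2} (1+|z|)^{-α} exp(−|x−z|²/s) dz ≤ C s^{-min(d,α)/2} (1 + 𝟙_{d=α} · log(1+s)), where 𝟙_{d=α} equals 1 if α = d and 0 otherwise. -/
open Real MeasureTheory

lemma exp_neg_sq_norm_sub_div_le {E : Type*} [SeminormedAddCommGroup E] {x z : E} {s : ℝ}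
    (hs : (1 + ‖x‖) ^ 2 ≤ s) :
    exp (-(‖x - z‖ ^ 2 / s)) ≤ exp 1 * exp (-(2 * s)⁻¹ * ‖z‖ ^ 2) := by
  have hx := norm_nonneg x
  have hs0 : 0 < s := lt_of_lt_of_le (by positivity) hs
  rw [← exp_add]
  apply exp_le_exp.mpr
  have hz : ‖z‖ ≤ ‖x‖ + ‖x - z‖ := by simpa using norm_sub_le x (x - z)
  have h2 : ‖z‖ ^ 2 ≤ 2 * s + 2 * ‖x - z‖ ^ 2 := by
    nlinarith [sq_nonneg (‖x‖ - ‖x - z‖), norm_nonneg z, norm_nonneg (x - z),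
      pow_le_pow_left₀ (norm_nonneg z) hz 2]
  have h3 : ‖z‖ ^ 2 / (2 * s) ≤ (2 * s + 2 * ‖x - z‖ ^ 2) / (2 * s) := by gcongr
  have h4 : (2 * s + 2 * ‖x - z‖ ^ 2) / (2 * s) = 1 + ‖x - z‖ ^ 2 / s := by field_simp
  rw [h4, div_eq_inv_mul] at h3
  linarith

lemma integrableOn_pow_mul_one_add_rpow_mul_exp_neg_mul_sq (n : ℕ) {α b : ℝ} (hα : 0 ≤ α)
    (hb : 0 < b) :
    IntegrableOn (fun y : ℝ ↦ y ^ n * ((1 + y) ^ (-α) * exp (-b * y ^ 2))) (Set.Ioi 0) := by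
  have h := integrableOn_rpow_mul_exp_neg_mul_sq hb (s := n) (by linarith [n.cast_nonneg (α := ℝ)])
  refine h.mono' (Measurable.aestronglyMeasurable (by fun_prop)) ?_
  filter_upwards [ae_restrict_mem measurableSet_Ioi] with y hy
  have hy : 0 < y := hy
  rw [norm_of_nonneg (by positivity), rpow_natCast]
  gcongr
  exact mul_le_of_le_one_left (exp_pos _).le
    (rpow_le_one_of_one_le_of_nonpos (by linarith) (by linarith))

lemma setIntegral_pow_mul_one_add_rpow_mul_exp_neg_le_of_lt (n : ℕ) {α s : ℝ} (h : α < n + 1)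
    (hα : 0 ≤ α) (hs : 0 < s) :
    ∫ y in Set.Ioi (0 : ℝ), y ^ n * ((1 + y) ^ (-α) * exp (-(2 * s)⁻¹ * y ^ 2)) ≤
      (2 ^ ((n + 1 - α) / 2) * (1 / 2) * Gamma ((n + 1 - α) / 2)) * s ^ ((n + 1 - α) / 2) := by
  have hb : 0 < (2 * s)⁻¹ := by positivity
  have hq : -1 < n - α := by linarith
  have hval := integral_rpow_mul_exp_neg_mul_rpow (p := 2) two_pos hq hb
  have hint := integrableOn_rpow_mul_exp_neg_mul_sq hb hq
  simp only [rpow_two] at hval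
  calc _ ≤ ∫ y in Set.Ioi (0 : ℝ), y ^ (n - α) * exp (-(2 * s)⁻¹ * y ^ 2) := by
        refine setIntegral_mono_of_nonneg (fun y hy ↦ ?_) (fun y hy ↦ ?_) hint
        · have hy : 0 < y := hy
          positivity
        · have hy : 0 < y := hy
          rw [← mul_assoc, sub_eq_add_neg, rpow_add hy, rpow_natCast]
          gcongr ?_ * ?_ * _
          exact rpow_le_rpow_of_nonpos hy (by linarith) (by linarith)
    _ = _ := by
        rw [hval, inv_rpow (by positivity), neg_div, rpow_neg (by positivity), inv_inv,
          mul_rpow (by positivity) hs.le, show (n : ℝ) - α + 1 = n + 1 - α by ring]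
        ring

lemma setIntegral_pow_mul_one_add_rpow_mul_exp_neg_le_log (n : ℕ) {s : ℝ} (hs : 1 ≤ s) :
    ∫ y in Set.Ioi (0 : ℝ), y ^ n * ((1 + y) ^ (-(n + 1 : ℝ)) * exp (-(2 * s)⁻¹ * y ^ 2)) ≤
      log (1 + s) + √(2 * π) / 2 := by
  have hs0 : 0 < s := by linarith
  have hr0 : 0 < √s := sqrt_pos.mpr hs0
  have hb : 0 < (2 * s)⁻¹ := by positivity
  have hcont : ContinuousOn (fun y : ℝ ↦ (1 + y)⁻¹) (Set.Icc 0 √s) :=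
    ContinuousOn.inv₀ (by fun_prop) fun y hy ↦ by linarith [hy.1]
  have hint1 : IntegrableOn (fun y : ℝ ↦ (1 + y)⁻¹) (Set.Ioc 0 √s) :=
    hcont.integrableOn_Icc.mono_set Set.Ioc_subset_Icc_self
  have hint1' : IntegrableOn ((Set.Ioc 0 √s).indicator fun y : ℝ ↦ (1 + y)⁻¹) (Set.Ioi 0) :=
    (hint1.integrable_indicator measurableSet_Ioc).integrableOn
  have hint2 : IntegrableOn (fun y : ℝ ↦ (√s)⁻¹ * exp (-(2 * s)⁻¹ * y ^ 2)) (Set.Ioi 0) :=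
    ((integrable_exp_neg_mul_sq hb).const_mul _).integrableOn
  have hval1 : ∫ y in Set.Ioi (0 : ℝ), (Set.Ioc 0 √s).indicator (fun y : ℝ ↦ (1 + y)⁻¹) y =
      log (1 + √s) := by
    rw [setIntegral_indicator measurableSet_Ioc, Set.inter_eq_right.mpr Set.Ioc_subset_Ioi_self,
      ← intervalIntegral.integral_of_le hr0.le,
      intervalIntegral.integral_comp_add_left (fun y : ℝ ↦ y⁻¹) 1,
      integral_inv_of_pos (by norm_num) (by positivity)]
    simp
  have hval2 : ∫ y in Set.Ioi (0 : ℝ), (√s)⁻¹ * exp (-(2 * s)⁻¹ * y ^ 2) = √(2 * π) / 2 := by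
    rw [integral_const_mul, integral_gaussian_Ioi, div_inv_eq_mul,
      show π * (2 * s) = (2 * π) * s by ring, sqrt_mul (by positivity)]
    field_simp
  calc _ ≤ ∫ y in Set.Ioi (0 : ℝ), ((Set.Ioc 0 √s).indicator (fun y : ℝ ↦ (1 + y)⁻¹) y +
        (√s)⁻¹ * exp (-(2 * s)⁻¹ * y ^ 2)) := by
        refine setIntegral_mono_of_nonneg (fun y hy ↦ ?_) (fun y hy ↦ ?_) (hint1'.add hint2)
        · have hy : 0 < y := hy
          positivity
        · have hy : 0 < y := hy
          have h1 : y ^ n * (1 + y) ^ (-(n + 1 : ℝ)) ≤ (1 + y)⁻¹ := by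
            calc _ ≤ (1 + y) ^ n * (1 + y) ^ (-(n + 1 : ℝ)) := by gcongr; linarith
              _ = (1 + y)⁻¹ := by
                rw [← rpow_natCast, ← rpow_add (by positivity), ← rpow_neg_one]
                congr 1
                ring
          rw [← mul_assoc]
          by_cases hys : y ≤ √s
          · rw [Set.indicator_of_mem (Set.mem_Ioc.mpr ⟨hy, hys⟩)]
            have h2 : exp (-(2 * s)⁻¹ * y ^ 2) ≤ 1 :=
              exp_le_one_iff.mpr (by rw [neg_mul]; exact neg_nonpos.mpr (by positivity))
            have h3 : 0 ≤ (√s)⁻¹ * exp (-(2 * s)⁻¹ * y ^ 2) := by positivity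
            have h4 := mul_le_of_le_one_right
              (show 0 ≤ y ^ n * (1 + y) ^ (-(n + 1 : ℝ)) by positivity) h2
            linarith
          · rw [Set.indicator_of_notMem fun h ↦ hys h.2, zero_add]
            gcongr
            refine h1.trans (inv_anti₀ hr0 ?_)
            linarith
    _ = log (1 + √s) + √(2 * π) / 2 := by rw [integral_add hint1' hint2, hval1, hval2]
    _ ≤ _ := by
        gcongr
        exact sqrt_le_iff.mpr ⟨hs0.le, by nlinarith⟩

lemma integrableOn_pow_mul_one_add_rpow (n : ℕ) {α : ℝ} (h : n + 1 < α) :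
    IntegrableOn (fun y : ℝ ↦ y ^ n * (1 + y) ^ (-α)) (Set.Ioi 0) := by
  have := integrable_one_add_norm (E := EuclideanSpace ℝ (Fin (n + 1))) (μ := volume) (r := α)
    (by simpa using h)
  simpa using (integrable_fun_norm_addHaar volume (f := fun y : ℝ ↦ (1 + y) ^ (-α))).mp this

lemma exists_setIntegral_pow_mul_one_add_rpow_mul_exp_neg_le (n : ℕ) {α : ℝ} (hα : 0 ≤ α) :
    ∃ C : ℝ, 0 ≤ C ∧ ∀ s : ℝ, 1 ≤ s →
      ∫ y in Set.Ioi (0 : ℝ), y ^ n * ((1 + y) ^ (-α) * exp (-(2 * s)⁻¹ * y ^ 2)) ≤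
        C * s ^ ((n + 1 - min (n + 1 : ℝ) α) / 2) *
          (1 + if α = n + 1 then log (1 + s) else 0) := by
  rcases lt_trichotomy α (n + 1) with h | rfl | h
  · refine ⟨2 ^ ((n + 1 - α) / 2) * (1 / 2) * Gamma ((n + 1 - α) / 2), ?_, fun s hs ↦ ?_⟩
    · have := Gamma_pos_of_pos (show 0 < (n + 1 - α) / 2 by linarith)
      positivity
    · rw [min_eq_right h.le, if_neg h.ne, add_zero, mul_one]
      exact setIntegral_pow_mul_one_add_rpow_mul_exp_neg_le_of_lt n h hα (by linarith)
  · refine ⟨1 + √(2 * π) / 2, by positivity, fun s hs ↦ ?_⟩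
    refine (setIntegral_pow_mul_one_add_rpow_mul_exp_neg_le_log n hs).trans ?_
    have h1 : 0 ≤ log (1 + s) := log_nonneg (by linarith)
    have h2 : 0 ≤ √(2 * π) / 2 := by positivity
    simp only [min_self, sub_self, zero_div, rpow_zero, mul_one, if_true]
    nlinarith [mul_nonneg h1 h2]
  · refine ⟨∫ y in Set.Ioi (0 : ℝ), y ^ n * (1 + y) ^ (-α),
      setIntegral_nonneg measurableSet_Ioi fun y hy ↦ ?_, fun s hs ↦ ?_⟩
    · have hy : 0 < y := hy
      positivity
    · rw [min_eq_left h.le, if_neg h.ne', sub_self, zero_div, rpow_zero, add_zero, mul_one, mul_one]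
      refine setIntegral_mono_of_nonneg (fun y hy ↦ ?_) (fun y hy ↦ ?_)
        (integrableOn_pow_mul_one_add_rpow n h)
      · have hy : 0 < y := hy
        positivity
      · have hy : 0 < y := hy
        gcongr
        refine mul_le_of_le_one_right (by positivity) (exp_le_one_iff.mpr ?_)
        rw [neg_mul]
        exact neg_nonpos.mpr (by positivity)

theorem stmt_4 (d : ℕ) (hd : 1 ≤ d) (α : ℝ) (hα : 2 < α) :
    ∃ C : ℝ, 0 < C ∧
      ∀ (x : EuclideanSpace ℝ (Fin d)) (s : ℝ), (1 + ‖x‖) ^ 2 ≤ s →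
        (∫ z : EuclideanSpace ℝ (Fin d),
            s ^ (-(d : ℝ) / 2) * (1 + ‖z‖) ^ (-α) * Real.exp (-(‖x - z‖ ^ 2 / s))) ≤
          C * s ^ (-(min (d : ℝ) α) / 2) *
            (1 + (if α = (d : ℝ) then Real.log (1 + s) else 0)) := by
  obtain ⟨n, rfl⟩ : ∃ n, d = n + 1 := ⟨d - 1, by omega⟩
  obtain ⟨C, hC, hbound⟩ :=
    exists_setIntegral_pow_mul_one_add_rpow_mul_exp_neg_le n (α := α) (by linarith)
  set E := EuclideanSpace ℝ (Fin (n + 1))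
  set K : ℝ := (n + 1) * volume.real (Metric.ball (0 : E) 1) with hK
  have hK0 : 0 ≤ K := by positivity
  refine ⟨exp 1 * K * C + 1, by positivity, fun x s hs ↦ ?_⟩
  have hs1 : 1 ≤ s := le_trans (by nlinarith [norm_nonneg x]) hs
  have hs0 : 0 < s := by linarith
  have hb : 0 < (2 * s)⁻¹ := by positivity
  let G : ℝ → ℝ := fun y ↦ (1 + y) ^ (-α) * exp (-(2 * s)⁻¹ * y ^ 2)
  have hG : Integrable (fun z : E ↦ G ‖z‖) := by
    rw [integrable_fun_norm_addHaar volume (f := G)]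
    simpa [E, G] using
      integrableOn_pow_mul_one_add_rpow_mul_exp_neg_mul_sq n (α := α) (by linarith) hb
  have hGval : ∫ z : E, G ‖z‖ = K * ∫ y in Set.Ioi (0 : ℝ), y ^ n * G y := by
    rw [integral_fun_norm_addHaar volume G]
    simp [E, hK, mul_assoc]
  set L : ℝ := 1 + if α = ((n + 1 : ℕ) : ℝ) then log (1 + s) else 0 with hL
  have hL0 : 0 ≤ L := by
    have : 0 ≤ log (1 + s) := log_nonneg (by linarith)
    rw [hL]
    split_ifs <;> linarith
  set m : ℝ := min ((n + 1 : ℕ) : ℝ) α with hm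
  calc _ ≤ ∫ z : E, (s ^ (-((n + 1 : ℕ) : ℝ) / 2) * exp 1) * G ‖z‖ := by
        refine integral_mono_of_nonneg (.of_forall fun z ↦ by positivity) (hG.const_mul _)
          (.of_forall fun z ↦ ?_)
        calc _ ≤ s ^ (-((n + 1 : ℕ) : ℝ) / 2) * (1 + ‖z‖) ^ (-α) *
              (exp 1 * exp (-(2 * s)⁻¹ * ‖z‖ ^ 2)) := by
              dsimp only
              gcongr
              exact exp_neg_sq_norm_sub_div_le hs
          _ = _ := by simp only [G]; ring
    _ = s ^ (-((n + 1 : ℕ) : ℝ) / 2) * exp 1 * (K * ∫ y in Set.Ioi (0 : ℝ), y ^ n * G y) := by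
        rw [integral_const_mul, hGval]
    _ ≤ s ^ (-((n + 1 : ℕ) : ℝ) / 2) * exp 1 *
          (K * (C * s ^ ((((n + 1 : ℕ) : ℝ) - m) / 2) * L)) := by
        gcongr
        have := hbound s hs1
        rw [hL, hm]
        push_cast
        exact this
    _ = exp 1 * K * C * s ^ (-m / 2) * L := by
        rw [show -m / 2 = -((n + 1 : ℕ) : ℝ) / 2 + (((n + 1 : ℕ) : ℝ) - m) / 2 by ring,
          rpow_add hs0]
        ring
    _ ≤ _ := by
        gcongr
        linarith
end

section
/- Let d ≥ 3 be an integer, α ∈ (2,∞), and let 0 < a < b be real constants. Then there exists a constant C > 0 such that for all t > 0 and all x,y ∈ ℝ^d, ∫₀^t ∫_{ℝ^d} (t−s)^{-d/2} exp(−b|x−z|²/(t−s)) (1+|z|)^{-α} s^{-d/2} exp(−a|z−y|²/s) dz ds ≤ C t^{-d/2} exp(−a|x−y|²/t). -/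
open Real MeasureTheory

/-- The unnormalised Gaussian kernel `τ ^ (-d / 2) * exp (-c ‖v‖² / τ)` on `ℝ ^ d`. -/
noncomputable def gaussKernel {d : ℕ} (c τ : ℝ) (v : EuclideanSpace ℝ (Fin d)) : ℝ :=
  τ ^ (-(d : ℝ) / 2) * Real.exp (-(c * ‖v‖ ^ 2 / τ))

lemma gaussKernel_nonneg {d : ℕ} (c : ℝ) {τ : ℝ} (hτ : 0 < τ) (v : EuclideanSpace ℝ (Fin d)) :
    0 ≤ gaussKernel c τ v := by
  unfold gaussKernel; positivity

lemma integral_gaussKernel {d : ℕ} {c τ : ℝ} (hc : 0 < c) (hτ : 0 < τ) :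
    ∫ v : EuclideanSpace ℝ (Fin d), gaussKernel c τ v = (π / c) ^ ((d : ℝ) / 2) := by
  have h := GaussianFourier.integral_rexp_neg_mul_sq_norm
    (V := EuclideanSpace ℝ (Fin d)) (div_pos hc hτ)
  rw [finrank_euclideanSpace_fin] at h
  have h' : ∀ v : EuclideanSpace ℝ (Fin d),
      gaussKernel c τ v = τ ^ (-(d : ℝ) / 2) * Real.exp (-(c / τ) * ‖v‖ ^ 2) := fun v => by
    unfold gaussKernel; congr 2; ring
  simp_rw [h']
  rw [integral_const_mul, h, show π / (c / τ) = π / c * τ by field_simp,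
    Real.mul_rpow (by positivity) hτ.le, mul_left_comm, ← Real.rpow_add hτ,
    show -(d : ℝ) / 2 + d / 2 = 0 by ring, Real.rpow_zero, mul_one]

lemma integrable_gaussKernel {d : ℕ} {c τ : ℝ} (hc : 0 < c) (hτ : 0 < τ) :
    Integrable (fun v : EuclideanSpace ℝ (Fin d) => gaussKernel c τ v) := by
  refine Integrable.of_integral_ne_zero ?_
  rw [integral_gaussKernel hc hτ]
  positivity

/-- Weighted Cauchy–Schwarz in the form of Sedrakyan's inequality, with a triangle inequality. -/
lemma sq_div_le_add_sq_div {p q r A B T : ℝ} (hr : 0 ≤ r) (hpq : r ≤ p + q)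
    (hA : 0 < A) (hB : 0 < B) (hT : A + B ≤ T) :
    r ^ 2 / T ≤ p ^ 2 / A + q ^ 2 / B := by
  calc r ^ 2 / T ≤ (p + q) ^ 2 / (A + B) := by gcongr
    _ ≤ p ^ 2 / A + q ^ 2 / B := by
      rw [div_add_div _ _ hA.ne' hB.ne', div_le_div_iff₀ (by positivity) (by positivity)]
      nlinarith [sq_nonneg (p * B - q * A)]

lemma quadratic_add_left_le {a b p q r τ s : ℝ} (ha : 0 < a) (hab : a < b)
    (hr : 0 ≤ r) (hpq : r ≤ p + q) (hτ : 0 < τ) (hs : 0 < s) :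
    a * r ^ 2 / (τ + s) + a * (b - a) / (2 * b - a) * p ^ 2 / τ
      ≤ b * p ^ 2 / τ + a * q ^ 2 / s := by
  have h := mul_le_mul_of_nonneg_left (sq_div_le_add_sq_div hr hpq hτ hs le_rfl) ha.le
  have hc : a * (b - a) / (2 * b - a) ≤ b - a := by
    rw [div_le_iff₀ (by linarith)]; nlinarith
  have h2 : a * (b - a) / (2 * b - a) * (p ^ 2 / τ) ≤ (b - a) * (p ^ 2 / τ) := by gcongr
  simp only [mul_div_assoc] at h h2 ⊢
  linarith

lemma quadratic_add_right_le {a b p q r τ s : ℝ} (ha : 0 < a) (hab : a < b)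
    (hr : 0 ≤ r) (hpq : r ≤ p + q) (hτ : 0 < τ) (hs : 0 < s) (hsτ : s ≤ τ) :
    a * r ^ 2 / (τ + s) + a * (b - a) / (2 * b - a) * q ^ 2 / s
      ≤ b * p ^ 2 / τ + a * q ^ 2 / s := by
  have hb : 0 < b := ha.trans hab
  have hba : 0 < 2 * b - a := by linarith
  have hT : a * τ / b + s * (2 * b - a) / b ≤ τ + s := by
    rw [← add_div, div_le_iff₀ hb]; nlinarith
  have h := mul_le_mul_of_nonneg_left
    (sq_div_le_add_sq_div hr hpq (by positivity) (by positivity) hT) ha.le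
  have e : a * (p ^ 2 / (a * τ / b) + q ^ 2 / (s * (2 * b - a) / b))
      = b * p ^ 2 / τ + a * q ^ 2 / s - a * (b - a) / (2 * b - a) * q ^ 2 / s := by
    have hc : a * (b - a) / (2 * b - a) = a - a * b / (2 * b - a) := by
      rw [eq_sub_iff_add_eq, ← add_div, div_eq_iff hba.ne']; ring
    rw [hc]
    generalize 2 * b - a = D at hba
    field_simp; ring
  rw [e, ← mul_div_assoc] at h
  linarith

/-- `n ≤ 2 m` costs a factor `2 ^ δ` when passing from `m ^ (-δ)` to `n ^ (-δ)`. -/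
lemma rpow_neg_le_two_rpow_mul {m n δ : ℝ} (hm : 0 < m) (hn : 0 < n) (hmn : n ≤ 2 * m)
    (hδ : 0 ≤ δ) : m ^ (-δ) ≤ 2 ^ δ * n ^ (-δ) := by
  have h : (2 * m) ^ (-δ) ≤ n ^ (-δ) := Real.rpow_le_rpow_of_nonpos hn hmn (by linarith)
  calc m ^ (-δ) = 2 ^ δ * (2 * m) ^ (-δ) := by
        rw [Real.mul_rpow two_pos.le hm.le, ← mul_assoc, ← Real.rpow_add two_pos]; simp
    _ ≤ _ := by gcongr

/-- The Gaussian factors are bounded by `exp (-a ‖x - y‖² / t)` times a Gaussian centred at `x`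
or at `y`. -/
lemma gaussKernel_mul_gaussKernel_le {d : ℕ} {a b τ s : ℝ} (ha : 0 < a) (hab : a < b)
    (hτ : 0 < τ) (hs : 0 < s) (x y z : EuclideanSpace ℝ (Fin d)) :
    gaussKernel b τ (x - z) * gaussKernel a s (z - y) ≤
      2 ^ ((d : ℝ) / 2) * gaussKernel a (τ + s) (x - y) *
        (gaussKernel (a * (b - a) / (2 * b - a)) τ (x - z) +
          gaussKernel (a * (b - a) / (2 * b - a)) s (z - y)) := by
  have hpq : ‖x - y‖ ≤ ‖x - z‖ + ‖z - y‖ := norm_sub_le_norm_sub_add_norm_sub x z y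
  have hx := gaussKernel_nonneg (a * (b - a) / (2 * b - a)) hτ (x - z)
  have hy := gaussKernel_nonneg (a * (b - a) / (2 * b - a)) hs (z - y)
  have h0 : 0 ≤ 2 ^ ((d : ℝ) / 2) * gaussKernel a (τ + s) (x - y) :=
    mul_nonneg (by positivity) (gaussKernel_nonneg a (by positivity) _)
  rcases le_total s τ with h | h
  · refine le_trans ?_ (mul_le_mul_of_nonneg_left (le_add_of_nonneg_left hx) h0)
    have hq := quadratic_add_right_le ha hab (norm_nonneg _) hpq hτ hs h
    have hp := rpow_neg_le_two_rpow_mul (δ := (d : ℝ) / 2) hτ (add_pos hτ hs) (by linarith)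
      (by positivity)
    rw [← neg_div] at hp
    unfold gaussKernel
    calc _ = τ ^ (-(d : ℝ) / 2) * s ^ (-(d : ℝ) / 2) *
          Real.exp (-(b * ‖x - z‖ ^ 2 / τ + a * ‖z - y‖ ^ 2 / s)) := by
          rw [neg_add, Real.exp_add]; ring
      _ ≤ (2 ^ ((d : ℝ) / 2) * (τ + s) ^ (-(d : ℝ) / 2)) * s ^ (-(d : ℝ) / 2) *
          Real.exp (-(a * ‖x - y‖ ^ 2 / (τ + s) +
            a * (b - a) / (2 * b - a) * ‖z - y‖ ^ 2 / s)) := by gcongr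
      _ = _ := by rw [neg_add, Real.exp_add]; ring
  · refine le_trans ?_ (mul_le_mul_of_nonneg_left (le_add_of_nonneg_right hy) h0)
    have hq := quadratic_add_left_le ha hab (norm_nonneg _) hpq hτ hs
    have hp := rpow_neg_le_two_rpow_mul (δ := (d : ℝ) / 2) hs (add_pos hτ hs) (by linarith)
      (by positivity)
    rw [← neg_div] at hp
    unfold gaussKernel
    calc _ = s ^ (-(d : ℝ) / 2) * τ ^ (-(d : ℝ) / 2) *
          Real.exp (-(b * ‖x - z‖ ^ 2 / τ + a * ‖z - y‖ ^ 2 / s)) := by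
          rw [neg_add, Real.exp_add]; ring
      _ ≤ (2 ^ ((d : ℝ) / 2) * (τ + s) ^ (-(d : ℝ) / 2)) * τ ^ (-(d : ℝ) / 2) *
          Real.exp (-(a * ‖x - y‖ ^ 2 / (τ + s) +
            a * (b - a) / (2 * b - a) * ‖x - z‖ ^ 2 / τ)) := by gcongr
      _ = _ := by rw [neg_add, Real.exp_add]; ring

/-- Trading integrability of the weight `w` for decay in `τ`. -/
lemma mul_gaussKernel_le {d : ℕ} {c τ β w : ℝ} (hc : 0 < c) (hτ : 0 < τ) (hβ : 0 < β)
    (hβd : β ≤ d) (hw : 0 ≤ w) (hw1 : w ≤ 1) (v : EuclideanSpace ℝ (Fin d)) :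
    w * gaussKernel c τ v ≤ 2 ^ ((d : ℝ) / 2) * (1 + τ) ^ (-(β / 2)) *
      (w ^ ((d : ℝ) / β) + gaussKernel c τ v) := by
  have hE := gaussKernel_nonneg c hτ v
  have hW : 0 ≤ w ^ ((d : ℝ) / β) := by positivity
  set E := gaussKernel c τ v with hEdef
  set σ := (1 + τ) ^ (-(β / 2)) with hσ
  have hσ0 : 0 < σ := by positivity
  have hd : (0 : ℝ) < d := hβ.trans_le hβd
  have hd0 : (0 : ℝ) ≤ (d : ℝ) / 2 := by positivity
  have h2 : (1 : ℝ) ≤ 2 ^ ((d : ℝ) / 2) := Real.one_le_rpow one_le_two hd0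
  rcases le_total w σ with h | h
  · calc w * E ≤ σ * E := by gcongr
      _ ≤ 2 ^ ((d : ℝ) / 2) * σ * E := by
        gcongr; exact le_mul_of_one_le_left hσ0.le h2
      _ ≤ _ := by gcongr; linarith
  rcases le_total τ 1 with h1 | h1
  · have h3 := rpow_neg_le_two_rpow_mul (m := 1) (δ := β / 2) one_pos
      (by linarith : 0 < 1 + τ) (by linarith) (by positivity)
    rw [Real.one_rpow] at h3
    calc w * E ≤ 1 * E := by gcongr
      _ ≤ 2 ^ (β / 2) * σ * E := by gcongr
      _ ≤ 2 ^ ((d : ℝ) / 2) * σ * E := by gcongr; exact one_le_two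
      _ ≤ _ := by gcongr; linarith
  · have hEτ : E ≤ τ ^ (-((d : ℝ) / 2)) := by
      rw [hEdef, gaussKernel, neg_div]
      refine mul_le_of_le_one_right (by positivity) (Real.exp_le_one_iff.2 ?_)
      rw [neg_nonpos]; positivity
    have h3 := rpow_neg_le_two_rpow_mul (δ := (d : ℝ) / 2) hτ
      (by linarith : 0 < 1 + τ) (by linarith) hd0
    have h4 : (1 + τ) ^ (-((d : ℝ) / 2)) = σ * σ ^ ((d : ℝ) / β - 1) := by
      rw [← Real.rpow_one_add' hσ0.le (by rw [add_sub_cancel]; positivity), hσ,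
        ← Real.rpow_mul (by positivity)]
      congr 1; field_simp; ring
    have h5 : 0 ≤ (d : ℝ) / β - 1 := by
      rw [sub_nonneg, le_div_iff₀ hβ]; linarith
    have h6 : w * w ^ ((d : ℝ) / β - 1) = w ^ ((d : ℝ) / β) := by
      rw [← Real.rpow_one_add' hw (by rw [add_sub_cancel]; positivity), add_sub_cancel]
    calc w * E ≤ w * (2 ^ ((d : ℝ) / 2) * (σ * σ ^ ((d : ℝ) / β - 1))) := by
          rw [← h4]; gcongr; exact hEτ.trans h3
      _ ≤ w * (2 ^ ((d : ℝ) / 2) * (σ * w ^ ((d : ℝ) / β - 1))) := by gcongr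
      _ = 2 ^ ((d : ℝ) / 2) * σ * w ^ ((d : ℝ) / β) := by rw [← h6]; ring
      _ ≤ _ := by gcongr; linarith

theorem stmt_5 (d : ℕ) (hd : 3 ≤ d) (α : ℝ) (hα : 2 < α) (a b : ℝ)
    (ha : 0 < a) (hab : a < b) :
    ∃ C : ℝ, 0 < C ∧
      ∀ (t : ℝ), 0 < t → ∀ (x y : EuclideanSpace ℝ (Fin d)),
        (∫ s in Set.Ioo (0:ℝ) t, ∫ z : EuclideanSpace ℝ (Fin d),
            (t - s) ^ (-(d : ℝ) / 2) * Real.exp (-(b * ‖x - z‖ ^ 2 / (t - s))) *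
              (1 + ‖z‖) ^ (-α) * s ^ (-(d : ℝ) / 2) *
              Real.exp (-(a * ‖z - y‖ ^ 2 / s))) ≤
          C * t ^ (-(d : ℝ) / 2) * Real.exp (-(a * ‖x - y‖ ^ 2 / t)) := by
  obtain ⟨β, hβ2, hβ⟩ := exists_between (lt_min hα (by norm_num : (2 : ℝ) < 3))
  obtain ⟨hβα, hβ3⟩ := lt_min_iff.1 hβ
  have hd3 : (3 : ℝ) ≤ d := by exact_mod_cast hd
  have hβ0 : 0 < β := by linarith
  set c := a * (b - a) / (2 * b - a)
  have hc : 0 < c := div_pos (mul_pos ha (by linarith)) (by linarith)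
  set H : ℝ → ℝ := fun s => (1 + ‖s‖) ^ (-(β / 2)) with hH
  have hHi : Integrable H := integrable_one_add_norm (by simp; linarith)
  have hH0 : ∀ s, 0 ≤ H s := fun s => by simp only [hH]; positivity
  set W : EuclideanSpace ℝ (Fin d) → ℝ := fun z => (1 + ‖z‖) ^ (-(α * (d / β))) with hW
  have hWi : Integrable W := integrable_one_add_norm (by
    rw [finrank_euclideanSpace_fin, ← mul_div_assoc, lt_div_iff₀ hβ0, mul_comm]
    gcongr)
  have hW0 : ∀ z, 0 ≤ W z := fun z => by simp only [hW]; positivity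
  set M := (∫ z, W z) + (π / c) ^ ((d : ℝ) / 2)
  have hM0 : 0 < M := add_pos_of_nonneg_of_pos (integral_nonneg hW0) (by positivity)
  set K : ℝ := 2 ^ ((d : ℝ) / 2)
  have hK0 : 0 < K := by positivity
  have hIH : 0 ≤ ∫ s, H s := integral_nonneg hH0
  refine ⟨K * K * M * (2 * ∫ s, H s) + 1, by positivity, fun t ht x y => ?_⟩
  set P := gaussKernel a t (x - y) with hP
  have hP0 : 0 ≤ P := gaussKernel_nonneg a ht _
  have inner_le : ∀ s ∈ Set.Ioo (0 : ℝ) t, (∫ z : EuclideanSpace ℝ (Fin d),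
      (t - s) ^ (-(d : ℝ) / 2) * Real.exp (-(b * ‖x - z‖ ^ 2 / (t - s))) *
        (1 + ‖z‖) ^ (-α) * s ^ (-(d : ℝ) / 2) * Real.exp (-(a * ‖z - y‖ ^ 2 / s))) ≤
      K * K * P * M * (H (t - s) + H s) := by
    rintro s ⟨hs, hst⟩
    have hτ : 0 < t - s := sub_pos.2 hst
    have hix : Integrable fun z => gaussKernel c (t - s) (x - z) :=
      (integrable_gaussKernel hc hτ).comp_sub_left x
    have hiy : Integrable fun z => gaussKernel c s (z - y) :=
      (integrable_gaussKernel hc hs).comp_sub_right y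
    have hWx := (hWi.fun_add hix).const_mul (H (t - s))
    have hWy := (hWi.fun_add hiy).const_mul (H s)
    have hint : ∫ z, K * K * P * (H (t - s) * (W z + gaussKernel c (t - s) (x - z)) +
        H s * (W z + gaussKernel c s (z - y))) = K * K * P * M * (H (t - s) + H s) := by
      rw [integral_const_mul, integral_add hWx hWy, integral_const_mul, integral_const_mul,
        integral_add hWi hix, integral_add hWi hiy,
        integral_sub_left_eq_self (fun v => gaussKernel c (t - s) v) volume x,
        integral_sub_right_eq_self (fun v => gaussKernel c s v) y,
        integral_gaussKernel hc hτ, integral_gaussKernel hc hs]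
      ring
    rw [← hint]
    refine integral_mono_of_nonneg (.of_forall fun z => by positivity)
      ((hWx.add hWy).const_mul _) (.of_forall fun z => ?_)
    set w : ℝ := (1 + ‖z‖) ^ (-α) with hw
    have hw0 : 0 ≤ w := by positivity
    have hw1 : w ≤ 1 := Real.rpow_le_one_of_one_le_of_nonpos
      (by linarith [norm_nonneg z]) (by linarith)
    have hwW : w ^ ((d : ℝ) / β) = W z := by
      rw [hw, ← Real.rpow_mul (by positivity), neg_mul]
    have hx := mul_gaussKernel_le hc hτ hβ0 (by linarith) hw0 hw1 (x - z)
    have hy := mul_gaussKernel_le hc hs hβ0 (by linarith) hw0 hw1 (z - y)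
    have hHτ : H (t - s) = (1 + (t - s)) ^ (-(β / 2)) := by
      simp only [hH, Real.norm_of_nonneg hτ.le]
    have hHs : H s = (1 + s) ^ (-(β / 2)) := by simp only [hH, Real.norm_of_nonneg hs.le]
    rw [hwW, ← hHτ] at hx
    rw [hwW, ← hHs] at hy
    have hG := gaussKernel_mul_gaussKernel_le ha hab hτ hs x y z
    rw [sub_add_cancel] at hG
    calc _ = w * (gaussKernel b (t - s) (x - z) * gaussKernel a s (z - y)) := by
          simp only [gaussKernel]; ring
      _ ≤ w * (K * P * (gaussKernel c (t - s) (x - z) + gaussKernel c s (z - y))) := by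
          gcongr
      _ = K * P * (w * gaussKernel c (t - s) (x - z) + w * gaussKernel c s (z - y)) := by ring
      _ ≤ K * P * (K * H (t - s) * (W z + gaussKernel c (t - s) (x - z)) +
            K * H s * (W z + gaussKernel c s (z - y))) := by gcongr
      _ = _ := by ring
  have hHr : Integrable fun s => H (t - s) := hHi.comp_sub_left t
  have hbi : Integrable fun s => K * K * P * M * (H (t - s) + H s) :=
    (hHr.add hHi).const_mul _
  calc _ ≤ ∫ s in Set.Ioo (0 : ℝ) t, K * K * P * M * (H (t - s) + H s) := by
        refine integral_mono_of_nonneg ?_ hbi.integrableOn ?_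
        · refine (ae_restrict_iff' measurableSet_Ioo).2 (.of_forall fun s hs => ?_)
          have hτ : 0 < t - s := sub_pos.2 hs.2
          have hs0 : 0 < s := hs.1
          exact integral_nonneg fun z => by positivity
        · exact (ae_restrict_iff' measurableSet_Ioo).2 (.of_forall inner_le)
    _ ≤ ∫ s, K * K * P * M * (H (t - s) + H s) :=
        setIntegral_le_integral hbi (.of_forall fun s =>
          mul_nonneg (by positivity) (add_nonneg (hH0 _) (hH0 _)))
    _ = K * K * M * (2 * ∫ s, H s) * P := by
        rw [integral_const_mul, integral_add hHr hHi, integral_sub_left_eq_self H volume t]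
        ring
    _ ≤ (K * K * M * (2 * ∫ s, H s) + 1) * P := by gcongr; linarith
    _ = _ := by rw [hP, gaussKernel, ← mul_assoc]
end

section
/- For every constant C > 0 there exist constants c₁, c₂ > 0 such that for all t > 0, b > 0 and r > 0, ∫₀^{t/2} s^{-1} exp(−C(s/b + r²/s)) ds ≥ c₁ exp(−c₂ (t/b + r/√b + r²/t)). -/
open Real MeasureTheory

theorem integrableOn_inv_mul_exp_neg {C b r : ℝ} (hC : 0 < C) (hb : 0 < b) (hr : 0 < r) (T : ℝ) :
    IntegrableOn (fun s : ℝ => s⁻¹ * Real.exp (-(C * (s / b + r ^ 2 / s)))) (Set.Ioo 0 T) := by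
  refine Measure.integrableOn_of_bounded (M := 1 / (C * r ^ 2)) (by simp)
    (by fun_prop) ?_
  refine (ae_restrict_iff' measurableSet_Ioo).2 (Filter.Eventually.of_forall fun s hs => ?_)
  have hs0 : 0 < s := hs.1
  rw [Real.norm_of_nonneg (by positivity), Real.exp_neg, ← mul_inv, ← one_div]
  apply one_div_le_one_div_of_le (by positivity)
  have hexp : C * r ^ 2 / s ≤ Real.exp (C * (s / b + r ^ 2 / s)) := by
    have h₁ := Real.add_one_le_exp (C * (s / b + r ^ 2 / s))
    have h₂ : 0 ≤ C * (s / b) := by positivity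
    have h₃ : C * (s / b + r ^ 2 / s) = C * (s / b) + C * r ^ 2 / s := by ring
    linarith
  rwa [div_le_iff₀' hs0] at hexp

theorem half_mul_exp_neg_le_setIntegral {C b r a T : ℝ} (hC : 0 < C) (hb : 0 < b) (hr : 0 < r)
    (ha : 0 < a) (haT : 2 * a ≤ T) :
    1 / 2 * Real.exp (-(C * (2 * a / b + r ^ 2 / a))) ≤
      ∫ s in Set.Ioo (0 : ℝ) T, s⁻¹ * Real.exp (-(C * (s / b + r ^ 2 / s))) := by
  have hint := integrableOn_inv_mul_exp_neg hC hb hr T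
  have hsub : Set.Ioo a (2 * a) ⊆ Set.Ioo 0 T := Set.Ioo_subset_Ioo ha.le haT
  calc 1 / 2 * Real.exp (-(C * (2 * a / b + r ^ 2 / a)))
      = ∫ _ in Set.Ioo a (2 * a), (2 * a)⁻¹ * Real.exp (-(C * (2 * a / b + r ^ 2 / a))) := by
        rw [setIntegral_const, Real.volume_real_Ioo_of_le (by linarith), smul_eq_mul]
        field_simp
        ring
    _ ≤ ∫ s in Set.Ioo a (2 * a), s⁻¹ * Real.exp (-(C * (s / b + r ^ 2 / s))) := by
        refine setIntegral_mono_on (integrableOn_const (by simp)) (hint.mono_set hsub)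
          measurableSet_Ioo fun s hs => ?_
        obtain ⟨has, hs2⟩ := hs
        have hs0 : 0 < s := ha.trans has
        gcongr
    _ ≤ _ := by
        refine setIntegral_mono_set hint ?_ hsub.eventuallyLE
        refine (ae_restrict_iff' measurableSet_Ioo).2 (Filter.Eventually.of_forall fun s hs => ?_)
        have hs0 : 0 < s := hs.1
        simp only [Pi.zero_apply]
        positivity

theorem stmt_7 (C : ℝ) (hC : 0 < C) :
    ∃ c₁ c₂ : ℝ, 0 < c₁ ∧ 0 < c₂ ∧
      ∀ (t b r : ℝ), 0 < t → 0 < b → 0 < r →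
        c₁ * Real.exp (-(c₂ * (t / b + r / Real.sqrt b + r ^ 2 / t))) ≤
          ∫ s in Set.Ioo (0:ℝ) (t / 2), s⁻¹ * Real.exp (-(C * (s / b + r ^ 2 / s))) := by
  refine ⟨1 / 2, 4 * C, by norm_num, by positivity, fun t b r ht hb hr => ?_⟩
  have hsb : 0 < Real.sqrt b := Real.sqrt_pos.2 hb
  have h₁ : 0 < t / b := by positivity
  have h₂ : 0 < r / Real.sqrt b := by positivity
  have h₃ : 0 < r ^ 2 / t := by positivity
  rcases le_total t (4 * (r * Real.sqrt b)) with h | h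
  · refine le_trans ?_ (half_mul_exp_neg_le_setIntegral hC hb hr (a := t / 4) (by positivity)
      (by linarith))
    have h₄ : 2 * (t / 4) / b + r ^ 2 / (t / 4) = (t / b) / 2 + 4 * (r ^ 2 / t) := by
      field_simp
      ring
    rw [h₄, mul_comm 4 C, mul_assoc]
    gcongr
    linarith
  · refine le_trans ?_ (half_mul_exp_neg_le_setIntegral hC hb hr (a := r * Real.sqrt b)
      (by positivity) (by linarith))
    have h₄ : 2 * (r * Real.sqrt b) / b + r ^ 2 / (r * Real.sqrt b) = 3 * (r / Real.sqrt b) := by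
      nth_rw 2 [← Real.sq_sqrt hb.le]
      field_simp
      ring
    rw [h₄, mul_comm 4 C, mul_assoc]
    gcongr <;> linarith
end

section
/- Let d ≥ 3 be an integer and α ∈ (2,∞). There exist constants K₀ > 0 and C > 0 with the following property. Let 0 < K ≤ K₀ and let V : ℝ^d → ℝ be a measurable function satisfying −K(1+|z|)^{-α} ≤ V(z) ≤ 0 for all z ∈ ℝ^d. Define the Duhamel iterates by p₀(t,x,y) := q(t,x,y) and p_{n+1}(t,x,y) := ∫₀^t ∫_{ℝ^d} q(t−s,x,z) (−V(z)) p_n(s,z,y) dz ds. Then for all t > 0 and all x,y ∈ ℝ^d, the series Σ_{n=0}^∞ p_n(t,x,y) converges and satisfies q(t,x,y) ≤ Σ_{n=0}^∞ p_n(t,x,y) ≤ C t^{-d/2} exp(−|x−y|²/(4t)). -/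
open Real MeasureTheory

theorem gaussian_mul_le {r s t a b c : ℝ} (hr : r ≤ 0) (hs : 0 < s) (hst : s < t)
    (hc : 0 ≤ c) (hcab : c ≤ a + b) :
    (2 * π * (t - s)) ^ r * exp (-(a ^ 2 / (2 * (t - s)))) * (s ^ r * exp (-(b ^ 2 / (4 * s)))) ≤
      ((t - s) ^ r * exp (-(a ^ 2 / (12 * (t - s)))) + s ^ r * exp (-(b ^ 2 / (12 * s)))) *
        (t ^ r * exp (-(c ^ 2 / (4 * t)))) := by
  have hτ : 0 < t - s := sub_pos.2 hst
  have ht : 0 < t := hs.trans hst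
  have hπ := pi_gt_three
  have hcsq : c ^ 2 ≤ (a + b) ^ 2 := pow_le_pow_left₀ hc hcab 2
  have h1 : 0 ≤ (t - s) ^ r * exp (-(a ^ 2 / (12 * (t - s)))) := by positivity
  have h2 : 0 ≤ s ^ r * exp (-(b ^ 2 / (12 * s))) := by positivity
  have h3 : 0 ≤ t ^ r * exp (-(c ^ 2 / (4 * t))) := by positivity
  have hexp : ∀ {P Q e f g h : ℝ}, 0 ≤ P → P ≤ Q → g + h ≤ e + f →
      P * (exp (-e) * exp (-f)) ≤ Q * (exp (-g) * exp (-h)) := by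
    intro P Q e f g h hP hPQ hle
    rw [← exp_add, ← exp_add]
    have : exp (-e + -f) ≤ exp (-g + -h) := exp_le_exp.2 (by linarith)
    exact mul_le_mul hPQ this (exp_pos _).le (hP.trans hPQ)
  have convex : ∀ {A B : ℝ}, 0 < A → 0 < B → c ^ 2 / (A + B) ≤ a ^ 2 / A + b ^ 2 / B := by
    intro A B hA hB
    refine (div_le_div_of_nonneg_right hcsq (by positivity)).trans ?_
    rw [div_add_div _ _ hA.ne' hB.ne', div_le_div_iff₀ (by positivity) (by positivity)]
    nlinarith [sq_nonneg (a * B - b * A)]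
  rcases le_total t (2 * s) with h | h
  · have key : (2 * π * (t - s)) ^ r * s ^ r ≤ (t - s) ^ r * t ^ r := by
      rw [← mul_rpow (by positivity) hs.le, ← mul_rpow hτ.le ht.le]
      apply rpow_le_rpow_of_nonpos (by positivity) _ hr
      nlinarith [mul_pos hτ hs]
    have hE : a ^ 2 / (12 * (t - s)) + c ^ 2 / (4 * t) ≤
        a ^ 2 / (2 * (t - s)) + b ^ 2 / (4 * s) := by
      have := convex (A := 4 * (t - s)) (B := 4 * s) (by positivity) (by positivity)
      rw [show 4 * (t - s) + 4 * s = 4 * t by ring] at this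
      have e1 : a ^ 2 / (2 * (t - s)) = a ^ 2 / (t - s) / 2 := by field_simp
      have e2 : a ^ 2 / (4 * (t - s)) = a ^ 2 / (t - s) / 4 := by field_simp
      have e3 : a ^ 2 / (12 * (t - s)) = a ^ 2 / (t - s) / 12 := by field_simp
      have : 0 ≤ a ^ 2 / (t - s) := by positivity
      linarith
    have := hexp (by positivity) key hE
    nlinarith [mul_nonneg h2 h3]
  · have key : (2 * π * (t - s)) ^ r * s ^ r ≤ s ^ r * t ^ r := by
      rw [← mul_rpow (by positivity) hs.le, ← mul_rpow hs.le ht.le]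
      apply rpow_le_rpow_of_nonpos (by positivity) _ hr
      nlinarith [mul_pos hτ hs]
    have hE : b ^ 2 / (12 * s) + c ^ 2 / (4 * t) ≤
        a ^ 2 / (2 * (t - s)) + b ^ 2 / (4 * s) := by
      have := convex (A := 2 * (t - s)) (B := 2 * t + 2 * s) (by positivity) (by positivity)
      rw [show 2 * (t - s) + (2 * t + 2 * s) = 4 * t by ring] at this
      have e0 : b ^ 2 / (2 * t + 2 * s) ≤ b ^ 2 / (6 * s) :=
        div_le_div_of_nonneg_left (by positivity) (by positivity) (by linarith)
      have e1 : b ^ 2 / (6 * s) = b ^ 2 / s / 6 := by field_simp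
      have e2 : b ^ 2 / (4 * s) = b ^ 2 / s / 4 := by field_simp
      have e3 : b ^ 2 / (12 * s) = b ^ 2 / s / 12 := by field_simp
      linarith
    have := hexp (by positivity) key hE
    nlinarith [mul_nonneg h1 h3]

theorem lintegral_gaussian {d : ℕ} {u : ℝ} (hu : 0 < u) (x : EuclideanSpace ℝ (Fin d)) :
    ∫⁻ z, ENNReal.ofReal (u ^ (-(d : ℝ) / 2) * exp (-(‖x - z‖ ^ 2 / (12 * u)))) =
      ENNReal.ofReal ((12 * π) ^ ((d : ℝ) / 2)) := by
  have h0 : ∫ z : EuclideanSpace ℝ (Fin d), exp (-(‖z‖ ^ 2 / (12 * u))) =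
      (12 * π * u) ^ ((d : ℝ) / 2) := by
    have := GaussianFourier.integral_rexp_neg_mul_sq_norm (V := EuclideanSpace ℝ (Fin d))
      (b := 1 / (12 * u)) (by positivity)
    rw [finrank_euclideanSpace_fin] at this
    convert this using 2
    · ext z; congr 1; ring
    · field_simp
  have hint : Integrable fun z : EuclideanSpace ℝ (Fin d) => exp (-(‖z‖ ^ 2 / (12 * u))) :=
    Integrable.of_integral_ne_zero (by rw [h0]; positivity)
  rw [lintegral_sub_left_eq_self
    (fun w => ENNReal.ofReal (u ^ (-(d : ℝ) / 2) * exp (-(‖w‖ ^ 2 / (12 * u))))) x,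
    ← ofReal_integral_eq_lintegral_ofReal (hint.const_mul _)
      (Filter.Eventually.of_forall fun z => by positivity),
    integral_const_mul, h0, mul_rpow (by positivity) hu.le, mul_left_comm, ← rpow_add hu,
    neg_div, neg_add_cancel, rpow_zero, mul_one]

theorem one_add_rpow_le {D a γ u w : ℝ} (hγa : 2 * γ ≤ a) (hγD : 2 * γ ≤ D) (hγ : 0 ≤ γ)
    (hu : 1 ≤ u) (hw : 0 ≤ w) :
    (1 + w) ^ (-a) ≤
      (4 * u) ^ (D / 2 - γ) * (1 + w) ^ (-(D + a - 2 * γ)) + u ^ (-γ) := by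
  have hu0 : 0 < u := by linarith
  have hsq := Real.sq_sqrt hu0.le
  have hs1 : 1 ≤ √u := Real.one_le_sqrt.2 hu
  have hw1 : 0 < 1 + w := by linarith
  rcases le_total (1 + w) (2 * √u) with h | h
  · have h1 : (1 + w) ^ (D - 2 * γ) ≤ (4 * u) ^ (D / 2 - γ) := by
      calc (1 + w) ^ (D - 2 * γ) ≤ (2 * √u) ^ (D - 2 * γ) :=
            rpow_le_rpow hw1.le h (by linarith)
        _ = ((2 * √u) ^ (2 : ℝ)) ^ (D / 2 - γ) := by
            rw [← rpow_mul (by positivity)]; ring_nf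
        _ = (4 * u) ^ (D / 2 - γ) := by
            rw [rpow_two, mul_pow, hsq]; norm_num
    calc (1 + w) ^ (-a) = (1 + w) ^ (D - 2 * γ) * (1 + w) ^ (-(D + a - 2 * γ)) := by
          rw [← rpow_add hw1]; ring_nf
      _ ≤ (4 * u) ^ (D / 2 - γ) * (1 + w) ^ (-(D + a - 2 * γ)) := by gcongr
      _ ≤ _ := le_add_of_nonneg_right (by positivity)
  · refine le_trans ?_ (le_add_of_nonneg_left (by positivity))
    calc (1 + w) ^ (-a) ≤ (1 + w) ^ (-(2 * γ)) :=
          rpow_le_rpow_of_exponent_le (by linarith) (by linarith)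
      _ ≤ (√u) ^ (-(2 * γ)) :=
          rpow_le_rpow_of_nonpos (by linarith) (by linarith) (by linarith)
      _ = ((√u) ^ (2 : ℝ)) ^ (-γ) := by
          rw [← rpow_mul (by positivity)]; ring_nf
      _ = u ^ (-γ) := by rw [rpow_two, hsq]

theorem exists_lintegral_gaussian_mul_le (d : ℕ) (hd : 3 ≤ d) (α : ℝ) (hα : 2 < α) :
    ∃ γ B : ℝ, 1 < γ ∧ 0 < B ∧ ∀ (u : ℝ), 0 < u → ∀ x : EuclideanSpace ℝ (Fin d),
      ∫⁻ z, ENNReal.ofReal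
          (u ^ (-(d : ℝ) / 2) * exp (-(‖x - z‖ ^ 2 / (12 * u))) * (1 + ‖z‖) ^ (-α)) ≤
        ENNReal.ofReal (B * (1 + ‖u‖) ^ (-γ)) := by
  have hd' : (3 : ℝ) ≤ d := by exact_mod_cast hd
  set a : ℝ := min α d
  have ha2 : 2 < a := lt_min hα (by linarith)
  have had : a ≤ d := min_le_right _ _
  have haα : a ≤ α := min_le_left _ _
  set γ : ℝ := (a + 2) / 4 with hγ
  have hγ1 : 1 < γ := by linarith
  have hint : Integrable fun z : EuclideanSpace ℝ (Fin d) =>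
      (1 + ‖z‖) ^ (-((d : ℝ) + a - 2 * γ)) := by
    apply integrable_one_add_norm
    rw [finrank_euclideanSpace_fin]
    linarith
  set I : ℝ := ∫ z : EuclideanSpace ℝ (Fin d), (1 + ‖z‖) ^ (-((d : ℝ) + a - 2 * γ))
  have hI : 0 ≤ I := integral_nonneg fun z => by positivity
  set G : ℝ := (12 * π) ^ ((d : ℝ) / 2)
  have hG : 0 < G := by positivity
  set L : ℝ := 4 ^ ((d : ℝ) / 2 - γ) * I + G
  have hGL : G ≤ L := le_add_of_nonneg_left (by positivity)
  have hL : 0 < L := hG.trans_le hGL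
  refine ⟨γ, 2 ^ γ * L, hγ1, by positivity, fun u hu x => ?_⟩
  rw [Real.norm_of_nonneg hu.le]
  rcases le_total u 1 with h1 | h1
  · calc _ ≤ ∫⁻ z, ENNReal.ofReal (u ^ (-(d : ℝ) / 2) * exp (-(‖x - z‖ ^ 2 / (12 * u)))) := by
          refine lintegral_mono fun z => ENNReal.ofReal_le_ofReal ?_
          refine mul_le_of_le_one_right (by positivity) ?_
          exact rpow_le_one_of_one_le_of_nonpos (by linarith [norm_nonneg z]) (by linarith)
      _ = ENNReal.ofReal G := lintegral_gaussian hu x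
      _ ≤ _ := by
          refine ENNReal.ofReal_le_ofReal (hGL.trans ?_)
          have : 2 ^ (-γ) ≤ (1 + u) ^ (-γ) :=
            rpow_le_rpow_of_nonpos (by linarith) (by linarith) (by linarith)
          calc L = 2 ^ γ * L * 2 ^ (-γ) := by
                rw [mul_right_comm, ← rpow_add two_pos, add_neg_cancel, rpow_zero, one_mul]
            _ ≤ _ := by gcongr
  · have hpt : ∀ z : EuclideanSpace ℝ (Fin d),
        u ^ (-(d : ℝ) / 2) * exp (-(‖x - z‖ ^ 2 / (12 * u))) * (1 + ‖z‖) ^ (-α) ≤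
          4 ^ ((d : ℝ) / 2 - γ) * u ^ (-γ) * (1 + ‖z‖) ^ (-((d : ℝ) + a - 2 * γ)) +
          u ^ (-γ) * (u ^ (-(d : ℝ) / 2) * exp (-(‖x - z‖ ^ 2 / (12 * u)))) := by
      intro z
      have hz := norm_nonneg z
      have h2 : (1 + ‖z‖) ^ (-α) ≤ _ :=
        (rpow_le_rpow_of_exponent_le (by linarith) (by linarith)).trans
          (one_add_rpow_le (D := d) (a := a) (γ := γ) (by linarith) (by linarith)
            (by linarith) h1 hz)
      refine (mul_le_mul_of_nonneg_left h2 (by positivity)).trans ?_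
      rw [mul_add]
      refine add_le_add ?_ (mul_comm _ _).le
      have he : exp (-(‖x - z‖ ^ 2 / (12 * u))) ≤ 1 :=
        exp_le_one_iff.2 (neg_nonpos.2 (by positivity))
      calc _ ≤ u ^ (-(d : ℝ) / 2) * 1 *
            ((4 * u) ^ ((d : ℝ) / 2 - γ) * (1 + ‖z‖) ^ (-((d : ℝ) + a - 2 * γ))) := by
            gcongr
        _ = 4 ^ ((d : ℝ) / 2 - γ) * (u ^ (-(d : ℝ) / 2) * u ^ ((d : ℝ) / 2 - γ)) *
            (1 + ‖z‖) ^ (-((d : ℝ) + a - 2 * γ)) := by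
            rw [mul_rpow (by norm_num) hu.le]; ring
        _ = _ := by
            rw [← rpow_add hu]; ring_nf
    calc _ ≤ ∫⁻ z : EuclideanSpace ℝ (Fin d), (ENNReal.ofReal
            (4 ^ ((d : ℝ) / 2 - γ) * u ^ (-γ) * (1 + ‖z‖) ^ (-((d : ℝ) + a - 2 * γ))) +
          ENNReal.ofReal (u ^ (-γ)) * ENNReal.ofReal
            (u ^ (-(d : ℝ) / 2) * exp (-(‖x - z‖ ^ 2 / (12 * u))))) := by
          refine lintegral_mono fun z => (ENNReal.ofReal_le_ofReal (hpt z)).trans ?_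
          rw [ENNReal.ofReal_add (by positivity) (by positivity),
            ENNReal.ofReal_mul (p := u ^ (-γ)) (by positivity)]
      _ = ENNReal.ofReal (4 ^ ((d : ℝ) / 2 - γ) * u ^ (-γ) * I) +
          ENNReal.ofReal (u ^ (-γ)) * ENNReal.ofReal G := by
          rw [lintegral_add_right' _ (by fun_prop),
            lintegral_const_mul' _ _ ENNReal.ofReal_ne_top, lintegral_gaussian hu x,
            ← ofReal_integral_eq_lintegral_ofReal (hint.const_mul _)
              (Filter.Eventually.of_forall fun z => by positivity), integral_const_mul]
      _ = ENNReal.ofReal (u ^ (-γ) * L) := by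
          rw [← ENNReal.ofReal_mul (by positivity),
            ← ENNReal.ofReal_add (by positivity) (by positivity)]
          congr 1; ring
      _ ≤ _ := by
          refine ENNReal.ofReal_le_ofReal ?_
          rw [mul_right_comm]
          refine mul_le_mul_of_nonneg_right ?_ hL.le
          have : (2 * u) ^ (-γ) ≤ (1 + u) ^ (-γ) :=
            rpow_le_rpow_of_nonpos (by linarith) (by linarith) (by linarith)
          calc u ^ (-γ) = 2 ^ γ * (2 * u) ^ (-γ) := by
                rw [mul_rpow two_pos.le hu.le, ← mul_assoc, ← rpow_add two_pos, add_neg_cancel,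
                  rpow_zero, one_mul]
            _ ≤ _ := by gcongr

theorem exists_duhamel_gaussian_le (d : ℕ) (hd : 3 ≤ d) (α : ℝ) (hα : 2 < α) :
    ∃ A : ℝ, 0 < A ∧ ∀ (t : ℝ) (x y : EuclideanSpace ℝ (Fin d)),
      ∫⁻ s in Set.Ioo 0 t, ∫⁻ z, ENNReal.ofReal
          ((2 * π * (t - s)) ^ (-(d : ℝ) / 2) * exp (-(‖x - z‖ ^ 2 / (2 * (t - s)))) *
            (1 + ‖z‖) ^ (-α) * (s ^ (-(d : ℝ) / 2) * exp (-(‖z - y‖ ^ 2 / (4 * s))))) ≤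
        ENNReal.ofReal (A * (t ^ (-(d : ℝ) / 2) * exp (-(‖x - y‖ ^ 2 / (4 * t))))) := by
  obtain ⟨γ, B, hγ, hB, hBle⟩ := exists_lintegral_gaussian_mul_le d hd α hα
  have hint : Integrable fun s : ℝ => B * (1 + ‖s‖) ^ (-γ) :=
    (integrable_one_add_norm (by simpa using hγ)).const_mul _
  set J : ℝ := ∫ s : ℝ, B * (1 + ‖s‖) ^ (-γ)
  have hJ : 0 ≤ J := integral_nonneg fun s => by positivity
  have hJl : ∫⁻ s : ℝ, ENNReal.ofReal (B * (1 + ‖s‖) ^ (-γ)) = ENNReal.ofReal J :=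
    (ofReal_integral_eq_lintegral_ofReal hint
      (Filter.Eventually.of_forall fun s => by positivity)).symm
  refine ⟨J + J + 1, by positivity, fun t x y => ?_⟩
  rcases le_or_gt t 0 with ht | ht
  · simp [Set.Ioo_eq_empty_of_le ht]
  set G : ℝ := t ^ (-(d : ℝ) / 2) * exp (-(‖x - y‖ ^ 2 / (4 * t))) with hGdef
  have hG : 0 ≤ G := by positivity
  have inner : ∀ s ∈ Set.Ioo 0 t, ∫⁻ z, ENNReal.ofReal
      ((2 * π * (t - s)) ^ (-(d : ℝ) / 2) * exp (-(‖x - z‖ ^ 2 / (2 * (t - s)))) *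
        (1 + ‖z‖) ^ (-α) * (s ^ (-(d : ℝ) / 2) * exp (-(‖z - y‖ ^ 2 / (4 * s))))) ≤
      (ENNReal.ofReal (B * (1 + ‖t - s‖) ^ (-γ)) + ENNReal.ofReal (B * (1 + ‖s‖) ^ (-γ))) *
        ENNReal.ofReal G := by
    rintro s ⟨hs, hst⟩
    have hτ : 0 < t - s := sub_pos.2 hst
    calc _ ≤ ∫⁻ z, (ENNReal.ofReal ((t - s) ^ (-(d : ℝ) / 2) *
              exp (-(‖x - z‖ ^ 2 / (12 * (t - s)))) * (1 + ‖z‖) ^ (-α)) +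
            ENNReal.ofReal (s ^ (-(d : ℝ) / 2) *
              exp (-(‖y - z‖ ^ 2 / (12 * s))) * (1 + ‖z‖) ^ (-α))) * ENNReal.ofReal G := by
          refine lintegral_mono fun z => ?_
          rw [← ENNReal.ofReal_add (by positivity) (by positivity),
            ← ENNReal.ofReal_mul (by positivity)]
          refine ENNReal.ofReal_le_ofReal ?_
          have key := gaussian_mul_le (r := -(d : ℝ) / 2) (a := ‖x - z‖) (b := ‖z - y‖)
            (div_nonpos_of_nonpos_of_nonneg (by simp) two_pos.le) hs hst (norm_nonneg (x - y))
            (norm_sub_le_norm_sub_add_norm_sub x z y)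
          rw [← hGdef, norm_sub_rev z y] at key
          rw [norm_sub_rev z y]
          have := mul_le_mul_of_nonneg_left key (by positivity : 0 ≤ (1 + ‖z‖) ^ (-α))
          linarith
      _ = ((∫⁻ z, ENNReal.ofReal ((t - s) ^ (-(d : ℝ) / 2) *
              exp (-(‖x - z‖ ^ 2 / (12 * (t - s)))) * (1 + ‖z‖) ^ (-α))) +
            ∫⁻ z, ENNReal.ofReal (s ^ (-(d : ℝ) / 2) *
              exp (-(‖y - z‖ ^ 2 / (12 * s))) * (1 + ‖z‖) ^ (-α))) * ENNReal.ofReal G := by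
          rw [lintegral_mul_const' _ _ ENNReal.ofReal_ne_top,
            lintegral_add_left (by fun_prop)]
      _ ≤ _ := by
          gcongr
          · exact hBle _ hτ x
          · exact hBle _ hs y
  calc _ ≤ ∫⁻ s in Set.Ioo 0 t, (ENNReal.ofReal (B * (1 + ‖t - s‖) ^ (-γ)) +
          ENNReal.ofReal (B * (1 + ‖s‖) ^ (-γ))) * ENNReal.ofReal G :=
        setLIntegral_mono' measurableSet_Ioo inner
    _ ≤ ∫⁻ s, (ENNReal.ofReal (B * (1 + ‖t - s‖) ^ (-γ)) +
          ENNReal.ofReal (B * (1 + ‖s‖) ^ (-γ))) * ENNReal.ofReal G :=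
        setLIntegral_le_lintegral _ _
    _ = ENNReal.ofReal ((J + J) * G) := by
        rw [lintegral_mul_const' _ _ ENNReal.ofReal_ne_top, lintegral_add_left (by fun_prop),
          lintegral_sub_left_eq_self (fun s : ℝ => ENNReal.ofReal (B * (1 + ‖s‖) ^ (-γ))) t,
          hJl, ← ENNReal.ofReal_add hJ hJ, ← ENNReal.ofReal_mul (by positivity)]
    _ ≤ _ := by
        exact ENNReal.ofReal_le_ofReal (mul_le_mul_of_nonneg_right (by linarith) hG)

theorem stmt_9 (d : ℕ) (hd : 3 ≤ d) (α : ℝ) (hα : 2 < α) :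
    ∃ K₀ C : ℝ, 0 < K₀ ∧ 0 < C ∧
      ∀ (K : ℝ), 0 < K → K ≤ K₀ →
        ∀ (V : EuclideanSpace ℝ (Fin d) → ℝ), Measurable V →
          (∀ z, -K * (1 + ‖z‖) ^ (-α) ≤ V z ∧ V z ≤ 0) →
          ∀ (p : ℕ → ℝ → EuclideanSpace ℝ (Fin d) → EuclideanSpace ℝ (Fin d) → ℝ),
            (∀ t x y, p 0 t x y =
              (2 * π * t) ^ (-(d : ℝ) / 2) * Real.exp (-(‖x - y‖ ^ 2 / (2 * t)))) →
            (∀ n t x y, p (n + 1) t x y =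
              ∫ s in Set.Ioo (0:ℝ) t, ∫ z : EuclideanSpace ℝ (Fin d),
                (2 * π * (t - s)) ^ (-(d : ℝ) / 2) *
                  Real.exp (-(‖x - z‖ ^ 2 / (2 * (t - s)))) * (-V z) * p n s z y) →
            ∀ (t : ℝ), 0 < t → ∀ x y,
              Summable (fun n => p n t x y) ∧
              (2 * π * t) ^ (-(d : ℝ) / 2) * Real.exp (-(‖x - y‖ ^ 2 / (2 * t))) ≤
                ∑' n, p n t x y ∧
              (∑' n, p n t x y) ≤
                C * t ^ (-(d : ℝ) / 2) * Real.exp (-(‖x - y‖ ^ 2 / (4 * t))) := by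
  obtain ⟨A, hA, hAle⟩ := exists_duhamel_gaussian_le d hd α hα
  refine ⟨1 / (2 * A), 2, by positivity, two_pos, ?_⟩
  intro K hK hKK V _ hV p hp0 hps
  have hKA : K * A ≤ 1 / 2 := by
    calc K * A ≤ 1 / (2 * A) * A := by gcongr
      _ = 1 / 2 := by field_simp
  have bound : ∀ n t, 0 < t → ∀ x y, 0 ≤ p n t x y ∧ p n t x y ≤
      (1 / 2) ^ n * (t ^ (-(d : ℝ) / 2) * exp (-(‖x - y‖ ^ 2 / (4 * t)))) := by
    intro n
    induction n with
    | zero =>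
      intro t ht x y
      rw [hp0, pow_zero, one_mul]
      refine ⟨by positivity, mul_le_mul ?_ ?_ (by positivity) (by positivity)⟩
      · refine rpow_le_rpow_of_nonpos ht (by nlinarith [pi_gt_three]) ?_
        exact div_nonpos_of_nonpos_of_nonneg (by simp) two_pos.le
      · refine exp_le_exp.2 (neg_le_neg ?_)
        exact div_le_div_of_nonneg_left (by positivity) (by positivity) (by linarith)
    | succ n ih =>
      intro t ht x y
      rw [hps]
      have hnonneg : ∀ s ∈ Set.Ioo 0 t, ∀ z, 0 ≤ (2 * π * (t - s)) ^ (-(d : ℝ) / 2) *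
          exp (-(‖x - z‖ ^ 2 / (2 * (t - s)))) * (-V z) * p n s z y := by
        rintro s ⟨hs, hst⟩ z
        have hτ : 0 < t - s := sub_pos.2 hst
        have h1 : 0 ≤ -V z := neg_nonneg.2 (hV z).2
        have h2 := (ih s hs z y).1
        positivity
      refine ⟨setIntegral_nonneg measurableSet_Ioo fun s hs =>
        integral_nonneg (hnonneg s hs), ?_⟩
      rw [← ENNReal.ofReal_le_ofReal_iff (by positivity)]
      refine (ENNReal.ofReal_le_ofReal (le_abs_self _)).trans ?_
      rw [← Real.norm_eq_abs, ofReal_norm]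
      calc _ ≤ ∫⁻ s in Set.Ioo 0 t, ∫⁻ z,
              ‖(2 * π * (t - s)) ^ (-(d : ℝ) / 2) *
                exp (-(‖x - z‖ ^ 2 / (2 * (t - s)))) * (-V z) * p n s z y‖ₑ :=
            (enorm_integral_le_lintegral_enorm _).trans
              (lintegral_mono fun s => enorm_integral_le_lintegral_enorm _)
        _ ≤ ∫⁻ s in Set.Ioo 0 t, ENNReal.ofReal (K * (1 / 2) ^ n) * ∫⁻ z, ENNReal.ofReal
              ((2 * π * (t - s)) ^ (-(d : ℝ) / 2) * exp (-(‖x - z‖ ^ 2 / (2 * (t - s)))) *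
                (1 + ‖z‖) ^ (-α) *
                (s ^ (-(d : ℝ) / 2) * exp (-(‖z - y‖ ^ 2 / (4 * s))))) := by
            refine setLIntegral_mono' measurableSet_Ioo fun s hs => ?_
            rw [← lintegral_const_mul' _ _ ENNReal.ofReal_ne_top]
            refine lintegral_mono fun z => ?_
            have hτ : 0 < t - s := sub_pos.2 hs.2
            rw [Real.enorm_of_nonneg (hnonneg s hs z), ← ENNReal.ofReal_mul (by positivity)]
            refine ENNReal.ofReal_le_ofReal ?_
            have h1 : -V z ≤ K * (1 + ‖z‖) ^ (-α) := by linarith [(hV z).1]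
            obtain ⟨h2, h3⟩ := ih s hs.1 z y
            calc _ ≤ (2 * π * (t - s)) ^ (-(d : ℝ) / 2) *
                  exp (-(‖x - z‖ ^ 2 / (2 * (t - s)))) * (K * (1 + ‖z‖) ^ (-α)) *
                  ((1 / 2) ^ n * (s ^ (-(d : ℝ) / 2) * exp (-(‖z - y‖ ^ 2 / (4 * s))))) := by
                  gcongr
              _ = _ := by ring
        _ ≤ ENNReal.ofReal (K * (1 / 2) ^ n) * ENNReal.ofReal
              (A * (t ^ (-(d : ℝ) / 2) * exp (-(‖x - y‖ ^ 2 / (4 * t))))) := by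
            rw [lintegral_const_mul' _ _ ENNReal.ofReal_ne_top]
            gcongr
            exact hAle t x y
        _ ≤ _ := by
            rw [← ENNReal.ofReal_mul (by positivity)]
            refine ENNReal.ofReal_le_ofReal ?_
            calc _ = K * A * ((1 / 2) ^ n *
                    (t ^ (-(d : ℝ) / 2) * exp (-(‖x - y‖ ^ 2 / (4 * t))))) := by ring
              _ ≤ 1 / 2 * ((1 / 2) ^ n *
                    (t ^ (-(d : ℝ) / 2) * exp (-(‖x - y‖ ^ 2 / (4 * t))))) := by gcongr
              _ = _ := by ring
  intro t ht x y
  have hgeom := hasSum_geometric_two.mul_right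
    (t ^ (-(d : ℝ) / 2) * exp (-(‖x - y‖ ^ 2 / (4 * t))))
  have hsum : Summable fun n => p n t x y :=
    .of_nonneg_of_le (fun n => (bound n t ht x y).1) (fun n => (bound n t ht x y).2)
      hgeom.summable
  refine ⟨hsum, ?_, ?_⟩
  · rw [← hp0]
    exact hsum.le_tsum 0 fun n _ => (bound n t ht x y).1
  · rw [mul_assoc, ← hgeom.tsum_eq]
    exact hsum.tsum_le_tsum (fun n => (bound n t ht x y).2) hgeom.summable
end

section
/- For every constant c > 0 there exist constants c₁, c₂ > 0 such that for all u > 0, ∫₀^u s^{-1} e^{-c/s} ds ≥ c₁ (1 + max(log u, 0)) e^{-c₂/u}. -/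
open Real MeasureTheory

theorem inv_mul_exp_neg_div_le {c s : ℝ} (hc : 0 < c) (hs : 0 < s) :
    s⁻¹ * Real.exp (-(c / s)) ≤ c⁻¹ := by
  have h : c / s ≤ Real.exp (c / s) := by linarith [Real.add_one_le_exp (c / s)]
  rw [Real.exp_neg, ← div_eq_mul_inv, div_le_iff₀ (Real.exp_pos _)]
  calc s⁻¹ = c⁻¹ * (c / s) := by field_simp
    _ ≤ c⁻¹ * Real.exp (c / s) := by gcongr

theorem integrableOn_inv_mul_exp_neg_div {c : ℝ} (hc : 0 < c) (u : ℝ) :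
    IntegrableOn (fun s : ℝ => s⁻¹ * Real.exp (-(c / s))) (Set.Ioc 0 u) := by
  refine Measure.integrableOn_of_bounded (M := c⁻¹) measure_Ioc_lt_top.ne
    (by fun_prop : Measurable _).aestronglyMeasurable ?_
  filter_upwards [ae_restrict_mem measurableSet_Ioc] with s hs
  have hs0 : 0 < s := hs.1
  rw [Real.norm_of_nonneg (by positivity)]
  exact inv_mul_exp_neg_div_le hc hs0

theorem log_div_mul_exp_neg_div_le_integral {c a u : ℝ} (hc : 0 < c) (ha : 0 < a) (hau : a ≤ u) :
    Real.log (u / a) * Real.exp (-(c / a)) ≤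
      ∫ s in Set.Ioc (0:ℝ) u, s⁻¹ * Real.exp (-(c / s)) := by
  have hsub : Set.Ioc a u ⊆ Set.Ioc 0 u := Set.Ioc_subset_Ioc_left ha.le
  have hint := integrableOn_inv_mul_exp_neg_div hc u
  have hinv : IntegrableOn (fun s : ℝ => s⁻¹) (Set.Ioc a u) := by
    rw [← intervalIntegrable_iff_integrableOn_Ioc_of_le hau, intervalIntegrable_inv_iff]
    right
    rw [Set.uIcc_of_le hau]
    exact fun h => ha.not_ge h.1
  calc Real.log (u / a) * Real.exp (-(c / a))
      = ∫ s in Set.Ioc a u, s⁻¹ * Real.exp (-(c / a)) := by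
        rw [integral_mul_const, ← intervalIntegral.integral_of_le hau,
          integral_inv_of_pos ha (ha.trans_le hau)]
    _ ≤ ∫ s in Set.Ioc a u, s⁻¹ * Real.exp (-(c / s)) := by
        refine setIntegral_mono_on (hinv.mul_const _) (hint.mono_set hsub) measurableSet_Ioc ?_
        intro s hs
        have has : a ≤ s := hs.1.le
        have hs0 : 0 < s := ha.trans hs.1
        gcongr
    _ ≤ ∫ s in Set.Ioc 0 u, s⁻¹ * Real.exp (-(c / s)) := by
        refine setIntegral_mono_set hint ?_ hsub.eventuallyLE
        filter_upwards [ae_restrict_mem measurableSet_Ioc] with s hs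
        have hs0 : 0 < s := hs.1
        simp only [Pi.zero_apply]
        positivity

theorem stmt_13 (c : ℝ) (hc : 0 < c) :
    ∃ c₁ c₂ : ℝ, 0 < c₁ ∧ 0 < c₂ ∧
      ∀ (u : ℝ), 0 < u →
        c₁ * (1 + max (Real.log u) 0) * Real.exp (-(c₂ / u)) ≤
          ∫ s in Set.Ioc (0:ℝ) u, s⁻¹ * Real.exp (-(c / s)) := by
  have hlog : 0 < Real.log 2 := Real.log_pos one_lt_two
  refine ⟨Real.log 2 * Real.exp (-(2 * c)), 2 * c, by positivity, by positivity, fun u hu => ?_⟩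
  rcases le_total u 1 with h | h
  · refine le_trans ?_ (log_div_mul_exp_neg_div_le_integral hc (half_pos hu) (half_le_self hu.le))
    rw [max_eq_right (Real.log_nonpos hu.le h), show u / (u / 2) = 2 by field_simp,
      show c / (u / 2) = 2 * c / u by field_simp, add_zero, mul_one]
    gcongr
    exact mul_le_of_le_one_right hlog.le (Real.exp_le_one_iff.2 (by linarith))
  · refine le_trans ?_ (log_div_mul_exp_neg_div_le_integral hc one_half_pos (by linarith))
    have hlogu : 0 ≤ Real.log u := Real.log_nonneg h
    have hexp : Real.exp (-(2 * c / u)) ≤ 1 := Real.exp_le_one_iff.2 (neg_nonpos.2 (by positivity))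
    rw [max_eq_left hlogu, show u / (1 / 2) = 2 * u by ring, show c / (1 / 2) = 2 * c by ring,
      Real.log_mul two_ne_zero hu.ne']
    refine (mul_le_of_le_one_right (by positivity) hexp).trans ?_
    rw [mul_right_comm]
    gcongr
    nlinarith [Real.log_two_lt_d9]
end

section
/- Let d ≥ 1 be an integer, α ∈ (2,∞) and c > 0. There exists a constant C > 0 such that for every s ≥ 1, Σ_{k=1}^∞ (1+k)^{-α} (k/√s)^{d-1} (1/√s) e^{-c k²/s} ≤ C s^{-min(d,α)/2} (1 + 𝟙_{d=α} · log(1+s)), where 𝟙_{d=α} equals 1 if α = d and 0 otherwise. -/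
open Real MeasureTheory

/-- A Gaussian factor is dominated by a power of `1 + 4 * u`. -/
lemma exp_neg_mul_le_one_add_rpow {c p u : ℝ} (hc : 0 < c) (hp : 0 < p) (hu : 0 ≤ u) :
    Real.exp (-(c * u)) ≤ (1 + 4 * p / c) ^ p * (1 + 4 * u) ^ (-p) := by
  have hA : 0 < 1 + 4 * p / c := by positivity
  have h1 : 1 + 4 * u ≤ (1 + 4 * p / c) * Real.exp (c * u / p) := by
    have h2 : c * u / p + 1 ≤ Real.exp (c * u / p) := Real.add_one_le_exp _
    have h3 : (1 + 4 * p / c) * (c * u / p + 1) = 1 + 4 * u + (c * u / p + 4 * p / c) := by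
      field_simp
      ring
    have h4 : 0 ≤ c * u / p + 4 * p / c := by positivity
    nlinarith [mul_le_mul_of_nonneg_left h2 hA.le]
  have h5 := Real.rpow_le_rpow (by positivity) h1 hp.le
  rw [Real.mul_rpow hA.le (Real.exp_pos _).le, ← Real.exp_mul, div_mul_cancel₀ _ hp.ne'] at h5
  rw [Real.rpow_neg (by positivity), Real.exp_neg, ← div_eq_mul_inv, le_div_iff₀ (by positivity),
    inv_mul_le_iff₀ (Real.exp_pos _), mul_comm (Real.exp _)]
  exact h5

/-- Up to a constant, `x ^ (γ - 1) * exp (-c x² / s)` is dominated on the interval `[x, x + 1]` by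
half the derivative of any primitive of `y ^ (γ / 2 - 1)` evaluated at `y = ξ² / (1 + ξ² / s)`. -/
lemma rpow_mul_gaussian_le {γ c s x ξ : ℝ} (hγ : 0 ≤ γ) (hc : 0 < c) (hs : 1 ≤ s) (hx : 1 ≤ x)
    (hxξ : x ≤ ξ) (hξx : ξ ≤ x + 1) :
    x ^ (γ - 1) * Real.exp (-(c * x ^ 2 / s)) ≤
      2 * (1 + 4 * (γ / 2 + 1) / c) ^ (γ / 2 + 1) *
        ((ξ ^ 2 / (1 + ξ ^ 2 / s)) ^ (γ / 2 - 1) * (ξ / (1 + ξ ^ 2 / s) ^ 2)) := by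
  have hx0 : 0 < x := by linarith
  have hξ0 : 0 < ξ := by linarith
  have hs0 : 0 < s := by linarith
  have hv : 0 < 1 + ξ ^ 2 / s := by positivity
  have hweight : (ξ ^ 2 / (1 + ξ ^ 2 / s)) ^ (γ / 2 - 1) * (ξ / (1 + ξ ^ 2 / s) ^ 2) =
      ξ ^ (γ - 1) * (1 + ξ ^ 2 / s) ^ (-(γ / 2 + 1)) := by
    rw [Real.div_rpow (by positivity) hv.le, ← Real.rpow_natCast_mul hξ0.le, Nat.cast_ofNat,
      show γ - 1 = 2 * (γ / 2 - 1) + 1 by ring, Real.rpow_add_one hξ0.ne',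
      show -(γ / 2 + 1) = -(γ / 2 - 1) - (2 : ℕ) by push_cast; ring,
      Real.rpow_sub_natCast hv.ne', Real.rpow_neg hv.le]
    field_simp
  have hpow : x ^ (γ - 1) ≤ 2 * ξ ^ (γ - 1) := by
    rw [Real.rpow_sub_one hx0.ne', Real.rpow_sub_one hξ0.ne', ← mul_div_assoc,
      div_le_div_iff₀ hx0 hξ0]
    have h := Real.rpow_le_rpow hx0.le hxξ hγ
    have h0 : 0 ≤ x ^ γ := by positivity
    nlinarith [mul_le_mul h (show ξ ≤ 2 * x by linarith) hξ0.le (h0.trans h)]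
  have hexp : Real.exp (-(c * x ^ 2 / s)) ≤
      (1 + 4 * (γ / 2 + 1) / c) ^ (γ / 2 + 1) * (1 + ξ ^ 2 / s) ^ (-(γ / 2 + 1)) := by
    have h := exp_neg_mul_le_one_add_rpow hc (show 0 < γ / 2 + 1 by positivity)
      (show 0 ≤ x ^ 2 / s by positivity)
    rw [← mul_div_assoc] at h
    refine h.trans (mul_le_mul_of_nonneg_left ?_ (by positivity))
    refine Real.rpow_le_rpow_of_nonpos hv ?_ (by linarith)
    rw [← mul_div_assoc]
    gcongr
    nlinarith
  rw [hweight]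
  calc _ ≤ _ := mul_le_mul hpow hexp (Real.exp_pos _).le (by positivity)
    _ = _ := by ring

lemma hasDerivAt_sq_div_one_add {s x : ℝ} (hs : 0 < s) :
    HasDerivAt (fun x : ℝ => x ^ 2 / (1 + x ^ 2 / s)) (2 * (x / (1 + x ^ 2 / s) ^ 2)) x := by
  have hv : 1 + x ^ 2 / s ≠ 0 := by positivity
  have h1 : HasDerivAt (fun x : ℝ => x ^ 2) (2 * x) x := by simpa using hasDerivAt_pow 2 x
  refine (h1.div ((h1.div_const s).const_add 1) hv).congr_deriv ?_
  field_simp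
  ring

/-- Comparison of the Gaussian sum with a primitive `H` of `y ^ (γ / 2 - 1)`. -/
lemma sum_rpow_mul_gaussian_le {γ c s : ℝ} (hγ : 0 ≤ γ) (hc : 0 < c) (hs : 1 ≤ s) {H : ℝ → ℝ}
    (hH : ∀ y, 0 < y → HasDerivAt H (y ^ (γ / 2 - 1)) y) (N : ℕ) :
    ∑ k ∈ Finset.range N,
        ((k + 1 : ℕ) : ℝ) ^ (γ - 1) * Real.exp (-(c * ((k + 1 : ℕ) : ℝ) ^ 2 / s)) ≤
      (1 + 4 * (γ / 2 + 1) / c) ^ (γ / 2 + 1) *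
        (H (((N + 1 : ℕ) : ℝ) ^ 2 / (1 + ((N + 1 : ℕ) : ℝ) ^ 2 / s)) - H (1 / (1 + 1 / s))) := by
  have hs0 : 0 < s := by linarith
  set M := (1 + 4 * (γ / 2 + 1) / c) ^ (γ / 2 + 1)
  set F : ℝ → ℝ := fun x => H (x ^ 2 / (1 + x ^ 2 / s)) with hF
  have hFd : ∀ x : ℝ, 0 < x → HasDerivAt F
      ((x ^ 2 / (1 + x ^ 2 / s)) ^ (γ / 2 - 1) * (2 * (x / (1 + x ^ 2 / s) ^ 2))) x := fun x hx =>
    (hH _ (by positivity)).comp x (hasDerivAt_sq_div_one_add hs0)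
  have hstep : ∀ k : ℕ,
      ((k + 1 : ℕ) : ℝ) ^ (γ - 1) * Real.exp (-(c * ((k + 1 : ℕ) : ℝ) ^ 2 / s)) ≤
        M * F ((k + 1 + 1 : ℕ) : ℝ) - M * F ((k + 1 : ℕ) : ℝ) := by
    intro k
    have hk : (1 : ℝ) ≤ ((k + 1 : ℕ) : ℝ) := by exact_mod_cast Nat.le_add_left 1 k
    rw [Nat.cast_succ (k + 1)]
    generalize ((k + 1 : ℕ) : ℝ) = x at hk ⊢
    obtain ⟨ξ, ⟨h1, h2⟩, h3⟩ := exists_hasDerivAt_eq_slope F _ (show x < x + 1 by linarith)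
      (fun y hy => (hFd y (by linarith [hy.1])).continuousAt.continuousWithinAt)
      (fun y hy => hFd y (by linarith [hy.1]))
    rw [add_sub_cancel_left, div_one] at h3
    rw [← mul_sub, ← h3]
    refine (rpow_mul_gaussian_le hγ hc hs hk h1.le h2.le).trans_eq ?_
    ring
  refine (Finset.sum_le_sum fun k _ => hstep k).trans_eq ?_
  rw [Finset.sum_range_sub (fun k : ℕ => M * F ((k + 1 : ℕ) : ℝ)), ← mul_sub]
  simp [hF]

/-- Growth in `s` of the partial sums of `n ^ (γ - 1) * exp (-c n² / s)`. -/
lemma exists_sum_rpow_mul_gaussian_le (γ : ℝ) {c : ℝ} (hc : 0 < c) :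
    ∃ K : ℝ, 0 < K ∧ ∀ s : ℝ, 1 ≤ s → ∀ N : ℕ,
      ∑ k ∈ Finset.range N,
          ((k + 1 : ℕ) : ℝ) ^ (γ - 1) * Real.exp (-(c * ((k + 1 : ℕ) : ℝ) ^ 2 / s)) ≤
        K * s ^ (max γ 0 / 2) * (1 + if γ = 0 then Real.log (1 + s) else 0) := by
  have hsat : ∀ s : ℝ, 1 ≤ s → ∀ x : ℝ, x ^ 2 / (1 + x ^ 2 / s) ≤ s := by
    intro s hs x
    have hs0 : 0 < s := by linarith
    rw [div_le_iff₀ (by positivity), mul_add, mul_div_cancel₀ _ hs0.ne']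
    linarith
  rcases lt_trichotomy γ 0 with hγ | rfl | hγ
  · have hsum : Summable fun k : ℕ => ((k + 1 : ℕ) : ℝ) ^ (γ - 1) :=
      (summable_nat_add_iff 1).2 (Real.summable_nat_rpow.2 (by linarith))
    refine ⟨1 + ∑' k : ℕ, ((k + 1 : ℕ) : ℝ) ^ (γ - 1), ?_, fun s hs N => ?_⟩
    · have : 0 ≤ ∑' k : ℕ, ((k + 1 : ℕ) : ℝ) ^ (γ - 1) := tsum_nonneg fun k => by positivity
      linarith
    · rw [max_eq_right hγ.le, if_neg hγ.ne]
      simp only [zero_div, Real.rpow_zero, mul_one, add_zero]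
      calc _ ≤ ∑ k ∈ Finset.range N, ((k + 1 : ℕ) : ℝ) ^ (γ - 1) := by
            refine Finset.sum_le_sum fun k _ => mul_le_of_le_one_right (by positivity) ?_
            exact Real.exp_le_one_iff.2 (neg_nonpos.2 (by positivity))
        _ ≤ _ := hsum.sum_le_tsum _ fun k _ => by positivity
        _ ≤ _ := by linarith
  · refine ⟨(1 + 4 * (0 / 2 + 1) / c) ^ ((0 : ℝ) / 2 + 1), by positivity, fun s hs N => ?_⟩
    have hs0 : 0 < s := by linarith
    refine (sum_rpow_mul_gaussian_le le_rfl hc hs (H := Real.log) (fun y hy => ?_) N).trans ?_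
    · simpa [Real.rpow_neg_one] using Real.hasDerivAt_log hy.ne'
    · simp only [max_self, zero_div, Real.rpow_zero, mul_one, if_true]
      refine mul_le_mul_of_nonneg_left ?_ (by positivity)
      have h1 := Real.log_le_log (by positivity) (hsat s hs ((N + 1 : ℕ) : ℝ))
      have h2 : 1 / (1 + 1 / s) = s / (1 + s) := by field_simp; ring
      rw [h2, Real.log_div hs0.ne' (by positivity)]
      linarith
  · refine ⟨(1 + 4 * (γ / 2 + 1) / c) ^ (γ / 2 + 1) * (2 / γ), by positivity, fun s hs N => ?_⟩
    have hs0 : 0 < s := by linarith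
    refine (sum_rpow_mul_gaussian_le hγ.le hc hs (H := fun y => 2 / γ * y ^ (γ / 2))
      (fun y hy => ?_) N).trans ?_
    · refine ((Real.hasDerivAt_rpow_const (p := γ / 2) (.inl hy.ne')).const_mul
        (2 / γ)).congr_deriv ?_
      field_simp
    · rw [max_eq_left hγ.le, if_neg hγ.ne', add_zero, mul_one, mul_assoc]
      refine mul_le_mul_of_nonneg_left ?_ (by positivity)
      have h1 := Real.rpow_le_rpow (by positivity) (hsat s hs ((N + 1 : ℕ) : ℝ))
        (show 0 ≤ γ / 2 by positivity)
      have h2 : 0 ≤ 2 / γ * (1 / (1 + 1 / s)) ^ (γ / 2) := by positivity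
      have h3 := mul_le_mul_of_nonneg_left h1 (show 0 ≤ 2 / γ by positivity)
      linarith

theorem stmt_17 (d : ℕ) (hd : 1 ≤ d) (α : ℝ) (hα : 2 < α) (c : ℝ) (hc : 0 < c) :
    ∃ C : ℝ, 0 < C ∧
      ∀ (s : ℝ), 1 ≤ s →
        Summable (fun k : ℕ =>
          (1 + ((k + 1 : ℕ) : ℝ)) ^ (-α) * (((k + 1 : ℕ) : ℝ) / Real.sqrt s) ^ (d - 1) *
            (1 / Real.sqrt s) * Real.exp (-(c * ((k + 1 : ℕ) : ℝ) ^ 2 / s))) ∧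
        (∑' k : ℕ,
            (1 + ((k + 1 : ℕ) : ℝ)) ^ (-α) * (((k + 1 : ℕ) : ℝ) / Real.sqrt s) ^ (d - 1) *
              (1 / Real.sqrt s) * Real.exp (-(c * ((k + 1 : ℕ) : ℝ) ^ 2 / s))) ≤
          C * s ^ (-(min (d : ℝ) α) / 2) *
            (1 + (if α = (d : ℝ) then Real.log (1 + s) else 0)) := by
  obtain ⟨K, hK, hbound⟩ := exists_sum_rpow_mul_gaussian_le ((d : ℝ) - α) hc
  refine ⟨K, hK, fun s hs => ?_⟩
  have hs0 : 0 < s := by linarith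
  have hscale : (1 / Real.sqrt s) ^ (d - 1) * (1 / Real.sqrt s) = s ^ (-(d : ℝ) / 2) := by
    rw [← pow_succ, Nat.sub_add_cancel hd, Real.sqrt_eq_rpow, one_div, ← Real.rpow_neg hs0.le,
      ← Real.rpow_mul_natCast hs0.le]
    ring_nf
  have hterm : ∀ k : ℕ,
      (1 + ((k + 1 : ℕ) : ℝ)) ^ (-α) * (((k + 1 : ℕ) : ℝ) / Real.sqrt s) ^ (d - 1) *
          (1 / Real.sqrt s) * Real.exp (-(c * ((k + 1 : ℕ) : ℝ) ^ 2 / s)) ≤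
        s ^ (-(d : ℝ) / 2) * (((k + 1 : ℕ) : ℝ) ^ ((d : ℝ) - α - 1) *
          Real.exp (-(c * ((k + 1 : ℕ) : ℝ) ^ 2 / s))) := by
    intro k
    have hk : (0 : ℝ) < ((k + 1 : ℕ) : ℝ) := by exact_mod_cast Nat.succ_pos k
    generalize ((k + 1 : ℕ) : ℝ) = x at hk ⊢
    have h1 : (1 + x) ^ (-α) ≤ x ^ (-α) :=
      Real.rpow_le_rpow_of_nonpos hk (by linarith) (by linarith)
    have h2 : x ^ ((d : ℝ) - α - 1) = x ^ (-α) * x ^ (d - 1) := by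
      rw [← Real.rpow_add_natCast hk.ne', Nat.cast_sub hd]
      push_cast
      ring_nf
    rw [← hscale, h2]
    calc _ ≤ x ^ (-α) * (x / Real.sqrt s) ^ (d - 1) * (1 / Real.sqrt s) *
          Real.exp (-(c * x ^ 2 / s)) := by gcongr
      _ = _ := by
        rw [div_eq_mul_one_div x, mul_pow]
        ring
  have hpartial : ∀ N : ℕ, ∑ k ∈ Finset.range N,
      ((1 + ((k + 1 : ℕ) : ℝ)) ^ (-α) * (((k + 1 : ℕ) : ℝ) / Real.sqrt s) ^ (d - 1) *
          (1 / Real.sqrt s) * Real.exp (-(c * ((k + 1 : ℕ) : ℝ) ^ 2 / s))) ≤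
        K * s ^ (-(min (d : ℝ) α) / 2) *
          (1 + (if α = (d : ℝ) then Real.log (1 + s) else 0)) := by
    intro N
    have hexpo : -(min (d : ℝ) α) / 2 = -(d : ℝ) / 2 + max ((d : ℝ) - α) 0 / 2 := by
      rcases le_total (d : ℝ) α with h | h
      · rw [min_eq_left h, max_eq_right (by linarith)]
        ring
      · rw [min_eq_right h, max_eq_left (by linarith)]
        ring
    have hiff : α = (d : ℝ) ↔ (d : ℝ) - α = 0 := by rw [sub_eq_zero, eq_comm]
    refine (Finset.sum_le_sum fun k _ => hterm k).trans ?_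
    rw [← Finset.mul_sum, hexpo, Real.rpow_add hs0]
    simp only [hiff]
    refine (mul_le_mul_of_nonneg_left (hbound s hs N) (by positivity)).trans_eq ?_
    ring
  exact ⟨summable_of_sum_range_le (fun k => by positivity) hpartial,
    Real.tsum_le_of_sum_range_le (fun k => by positivity) hpartial⟩
end
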